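/- arXiv:2605.20949 — 3 statements merged into one kernel-verified Lean document; each statement's English description precedes it below -/
import Mathlib

section
/- Let r,ℓ≥2 be integers, let t_1≥…≥t_ℓ>r be integers, and let F be an r-graph satisfying m_r(F) < m_r(K^{(r)}_{t_ℓ}). Then there exists an r-graph G such that G ↛ (K^{(r)}_{t_1},…,K^{(r)}_{t_ℓ}) and G → (K^{(r)}_s, F), where s = R(K^{(r)}_{t_1},…,K^{(r)}_{t_ℓ}) − 1. -/
open Finset

/-- An `r`-uniform hypergraph with vertices in `ℕ`. -/
structure HGraph (r : ℕ) where
  verts : Finset ℕ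
  edges : Finset (Finset ℕ)
  edge_sub : ∀ e ∈ edges, e ⊆ verts
  edge_card : ∀ e ∈ edges, e.card = r

/-- The complete `r`-graph `K_t^{(r)}` on vertex set `{0, …, t-1}`. -/
def completeHG (r t : ℕ) : HGraph r where
  verts := Finset.range t
  edges := (Finset.range t).powersetCard r
  edge_sub := fun _ he => (Finset.mem_powersetCard.mp he).1
  edge_card := fun _ he => (Finset.mem_powersetCard.mp he).2

/-- There is a copy of `F` in `G` all of whose edges satisfy `Q`. -/
def HasCopyWith {r : ℕ} (F G : HGraph r) (Q : Finset ℕ → Prop) : Prop :=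
  ∃ φ : ℕ → ℕ, Set.InjOn φ ↑F.verts ∧ (∀ v ∈ F.verts, φ v ∈ G.verts) ∧
    ∀ e ∈ F.edges, e.image φ ∈ G.edges ∧ Q (e.image φ)

/-- There is a copy of `F` in `G`. -/
def HasCopy {r : ℕ} (F G : HGraph r) : Prop := HasCopyWith F G fun _ => True

/-- `G → (F 0, …, F (l-1))`: every `l`-coloring of the edges of `G` yields a copy of
`F i` that is monochromatic in color `i`, for some `i`. -/
def ArrowsList {r : ℕ} (G : HGraph r) (l : ℕ) (F : Fin l → HGraph r) : Prop :=
  ∀ c : Finset ℕ → Fin l, ∃ i : Fin l, HasCopyWith (F i) G fun e => c e = i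

/-- `G → (F₁, F₂)`: every red-blue (`true`/`false`) coloring of the edges of `G` yields
a red copy of `F₁` or a blue copy of `F₂`. -/
def Arrows2 {r : ℕ} (G F1 F2 : HGraph r) : Prop :=
  ∀ c : Finset ℕ → Bool,
    HasCopyWith F1 G (fun e => c e = true) ∨ HasCopyWith F2 G (fun e => c e = false)

/-- The Ramsey number `R(F 0, …, F (l-1))`. -/
noncomputable def ramseyList (r l : ℕ) (F : Fin l → HGraph r) : ℕ :=
  sInf {n | ∃ G : HGraph r, G.verts.card = n ∧ ArrowsList G l F}

/-- The two-color Ramsey number `R(F₁, F₂)`. -/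
noncomputable def ramsey2 (r : ℕ) (F1 F2 : HGraph r) : ℕ :=
  sInf {n | ∃ G : HGraph r, G.verts.card = n ∧ Arrows2 G F1 F2}

/-- `J` is a subgraph of `F`. -/
def HGSub {r : ℕ} (J F : HGraph r) : Prop := J.verts ⊆ F.verts ∧ J.edges ⊆ F.edges

/-- The maximum `r`-density `m_r(F)`. -/
noncomputable def mDensity (r : ℕ) (F : HGraph r) : ℝ :=
  if F.edges.card = 0 then 0
  else if F.edges.card = 1 then 1 / r
  else sSup {x : ℝ | ∃ J : HGraph r, HGSub J F ∧ r < J.verts.card ∧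
    x = ((J.edges.card : ℝ) - 1) / ((J.verts.card : ℝ) - (r : ℝ))}

/-- The primal `r`-graph `G[H,r]` of an `s`-graph `H`. -/
def primal (r : ℕ) {s : ℕ} (H : HGraph s) : HGraph r where
  verts := H.verts
  edges := H.edges.biUnion fun A => A.powersetCard r
  edge_sub := by
    intro e he
    obtain ⟨A, hA, heA⟩ := Finset.mem_biUnion.mp he
    exact (Finset.mem_powersetCard.mp heA).1.trans (H.edge_sub A hA)
  edge_card := by
    intro e he
    obtain ⟨A, hA, heA⟩ := Finset.mem_biUnion.mp he
    exact (Finset.mem_powersetCard.mp heA).2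

/-- `H` is `r`-linear: every `r`-set of vertices lies in at most one edge. -/
def RLinear (r : ℕ) {s : ℕ} (H : HGraph s) : Prop :=
  ∀ A ∈ H.edges, ∀ B ∈ H.edges, ∀ e : Finset ℕ, e.card = r → e ⊆ A → e ⊆ B → A = B

/-- `H` is `(r,t)`-conformal: every `t`-set of vertices spanning a clique in the primal
`r`-graph is contained in an edge of `H`. -/
def HGConformal (r t : ℕ) {s : ℕ} (H : HGraph s) : Prop :=
  ∀ W : Finset ℕ, W ⊆ H.verts → W.card = t →
    (∀ B ∈ W.powersetCard r, B ∈ (primal r H).edges) → ∃ A ∈ H.edges, W ⊆ A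

/-- `E` is an `r`-cover of `W`: every `r`-subset of `W` lies in a member of `E`. -/
def IsRCover (r : ℕ) (W : Finset ℕ) (E : Finset (Finset ℕ)) : Prop :=
  ∀ B ∈ W.powersetCard r, ∃ A ∈ E, B ⊆ A

/-- `E` is a minimal non-trivial `r`-cover of `W`. -/
def MinNontrivCover (r : ℕ) (W : Finset ℕ) (E : Finset (Finset ℕ)) : Prop :=
  IsRCover r W E ∧ E.card ≠ 1 ∧ ∀ E' ⊂ E, ¬ IsRCover r W E'

/-- `S ⊑ H`: there are `e(S)` distinct edges of `H`, one containing each edge of `S`. -/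
def SqSub {r s : ℕ} (S : HGraph r) (H : HGraph s) : Prop :=
  ∃ f : Finset ℕ → Finset ℕ, Set.InjOn f ↑S.edges ∧
    ∀ e ∈ S.edges, f e ∈ H.edges ∧ e ⊆ f e

/-- The number of (labeled) copies of `F` in `G` all of whose edges satisfy `Q`. -/
noncomputable def copyCountWith {r : ℕ} (F G : HGraph r) (Q : Finset ℕ → Prop) : ℕ :=
  Set.ncard { φ : ℕ → ℕ | (∀ v, v ∉ F.verts → φ v = 0) ∧ Set.InjOn φ ↑F.verts ∧
    (∀ v ∈ F.verts, φ v ∈ G.verts) ∧ ∀ e ∈ F.edges, e.image φ ∈ G.edges ∧ Q (e.image φ) }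

/-- The number of (labeled) copies of `F` in `G`. -/
noncomputable def copyCount {r : ℕ} (F G : HGraph r) : ℕ :=
  copyCountWith F G fun _ => True

/-- Finite Ramsey theorem for `r`-subsets and two colors, in the asymmetric form. -/
theorem exists_ramsey_bound (r a b : ℕ) :
    ∃ N : ℕ, ∀ (α : Type) [DecidableEq α] (T : Finset α) (c : Finset α → Prop), N ≤ T.card →
      (∃ B ⊆ T, B.card = a ∧ ∀ e ⊆ B, e.card = r → c e) ∨
        ∃ B ⊆ T, B.card = b ∧ ∀ e ⊆ B, e.card = r → ¬ c e := by
  induction r generalizing a b with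
  | zero =>
    refine ⟨max a b, fun α _ T c hT => ?_⟩
    obtain ⟨A, hAT, hA⟩ := Finset.exists_subset_card_eq (le_trans (le_max_left a b) hT)
    obtain ⟨B, hBT, hB⟩ := Finset.exists_subset_card_eq (le_trans (le_max_right a b) hT)
    by_cases hc : c ∅
    · refine Or.inl ⟨A, hAT, hA, fun e _ he => ?_⟩
      rwa [Finset.card_eq_zero.mp he]
    · refine Or.inr ⟨B, hBT, hB, fun e _ he => ?_⟩
      rwa [Finset.card_eq_zero.mp he]
  | succ r ihr =>
    have key : ∀ n a b, a + b = n → ∃ N : ℕ, ∀ (α : Type) [DecidableEq α] (T : Finset α)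
        (c : Finset α → Prop), N ≤ T.card →
        (∃ B ⊆ T, B.card = a ∧ ∀ e ⊆ B, e.card = r + 1 → c e) ∨
          ∃ B ⊆ T, B.card = b ∧ ∀ e ⊆ B, e.card = r + 1 → ¬ c e := by
      intro n
      induction n with
      | zero =>
        intro a b hab
        refine ⟨0, fun α _ T c _ => Or.inl ⟨∅, by simp, by simp; omega, fun e he h => ?_⟩⟩
        rw [Finset.subset_empty.mp he] at h
        simp at h
      | succ n ihn =>
        intro a b hab
        rcases a with _ | a
        · refine ⟨0, fun α _ T c _ => Or.inl ⟨∅, by simp, by simp, fun e he h => ?_⟩⟩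
          rw [Finset.subset_empty.mp he] at h
          simp at h
        rcases b with _ | b
        · refine ⟨0, fun α _ T c _ => Or.inr ⟨∅, by simp, by simp, fun e he h => ?_⟩⟩
          rw [Finset.subset_empty.mp he] at h
          simp at h
        obtain ⟨N₁, h₁⟩ := ihn a (b + 1) (by omega)
        obtain ⟨N₂, h₂⟩ := ihn (a + 1) b (by omega)
        obtain ⟨N, h⟩ := ihr N₁ N₂
        refine ⟨N + 1, fun α _ T c hT => ?_⟩
        obtain ⟨x, hx⟩ : T.Nonempty := Finset.card_pos.mp (by omega)
        have hext : ∀ (q : Finset α → Prop) (B C : Finset α), B ⊆ C →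
            (∀ e ⊆ C, e.card = r → q (insert x e)) → (∀ e ⊆ B, e.card = r + 1 → q e) →
            ∀ e ⊆ insert x B, e.card = r + 1 → q e := by
          intro q B C hBC hC hB e he hcard
          by_cases hxe : x ∈ e
          · have := hC (e.erase x) ((Finset.subset_insert_iff.mp he).trans hBC)
              (by rw [Finset.card_erase_of_mem hxe]; omega)
            rwa [Finset.insert_erase hxe] at this
          · exact hB e ((Finset.subset_insert_iff_of_notMem hxe).mp he) hcard
        have hsub : T.erase x ⊆ T := Finset.erase_subset x T
        have hins : ∀ B ⊆ T.erase x, insert x B ⊆ T ∧ (insert x B).card = B.card + 1 :=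
          fun B hB => ⟨Finset.insert_subset hx (hB.trans hsub),
            Finset.card_insert_of_notMem fun h => Finset.notMem_erase x T (hB h)⟩
        rcases h α (T.erase x) (fun e => c (insert x e))
          (by rw [Finset.card_erase_of_mem hx]; omega) with ⟨C, hCT, hC, hred⟩ | ⟨C, hCT, hC, hblue⟩
        · rcases h₁ α C c hC.ge with ⟨B, hBC, hB, hBr⟩ | ⟨B, hBC, hB, hBb⟩
          · have := hins B (hBC.trans hCT)
            exact Or.inl ⟨insert x B, this.1, by omega, hext c B C hBC hred hBr⟩
          · exact Or.inr ⟨B, hBC.trans (hCT.trans hsub), hB, hBb⟩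
        · rcases h₂ α C c hC.ge with ⟨B, hBC, hB, hBr⟩ | ⟨B, hBC, hB, hBb⟩
          · exact Or.inl ⟨B, hBC.trans (hCT.trans hsub), hB, hBr⟩
          · have := hins B (hBC.trans hCT)
            exact Or.inr ⟨insert x B, this.1, by omega, hext (fun e => ¬ c e) B C hBC hblue hBb⟩
    exact key _ a b rfl

/-- A set `H` of hyperedges on `X` with projection `π` to `V`: hyperedges have `s` elements and
are transversal to the fibers of `π`, distinct hyperedges share fewer than `r` vertices, and
every set of at least `t` vertices whose `r`-subsets are all covered by hyperedges lies in a
single hyperedge. -/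
structure IsPartiteSystem {X V : Type} (r s t : ℕ) (π : X → V) (H : Set (Set X)) : Prop where
  injOn : ∀ A ∈ H, Set.InjOn π A
  card : ∀ A ∈ H, A.ncard = s
  linear : ∀ A ∈ H, ∀ B ∈ H, ∀ S : Set X, S.ncard = r → S ⊆ A → S ⊆ B → A = B
  conformal : ∀ W : Set X, t ≤ W.ncard → (∀ S ⊆ W, S.ncard = r → ∃ A ∈ H, S ⊆ A) →
    ∃ A ∈ H, W ⊆ A

open Classical in
/-- The coordinate of a vertex `x` at a position of a combinatorial line: `x` itself at an active
position, and the vertex of the fixed hyperedge in the fiber of `x` otherwise. -/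
noncomputable def lineCoord {X V : Type} (π : X → V) {α : Set (Set X)} (o : Option α) (x : X) :
    X :=
  match o with
  | none => x
  | some A => if h : ∃ y ∈ A.1, π y = π x then h.choose else x

open Classical in
/-- The embedding of a system into its partite amalgam over `B` given by a line `L`. -/
noncomputable def lineEmb {X V ι : Type} (π : X → V) (B : Set V) {α : Set (Set X)}
    (L : ι → Option α) (x : X) : V × (ι → X) × Option (ι → Option α) :=
  (π x, if π x ∈ B then fun i => lineCoord π (L i) x else fun _ => x,
    if π x ∈ B then none else some L)

section PartiteStep

variable {X V ι : Type} {r s t : ℕ} {π : X → V} {H : Set (Set X)} {B : Set V}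

/-- The hyperedges lying over `B`. -/
def edgesOver (π : X → V) (H : Set (Set X)) (B : Set V) : Set (Set X) := {A ∈ H | π '' A = B}

/-- The hyperedge at a position of a line. -/
def lineEdge {α : Set (Set X)} (o : Option α) (A : Set X) : Set X := (o.map Subtype.val).getD A

theorem lineEdge_mem (o : Option (edgesOver π H B)) {A : Set X} (hA : A ∈ H) :
    lineEdge o A ∈ H := by
  rcases o with _ | ⟨A', hA'⟩
  · exact hA
  · exact hA'.1

theorem lineCoord_spec (o : Option (edgesOver π H B)) {A : Set X} {x : X} (hx : x ∈ A)
    (hxB : π x ∈ B) : lineCoord π o x ∈ lineEdge o A ∧ π (lineCoord π o x) = π x := by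
  rcases o with _ | ⟨A', hA'⟩
  · exact ⟨hx, rfl⟩
  · have h : ∃ y ∈ A', π y = π x := by
      rw [← hA'.2] at hxB
      exact hxB
    simp only [lineCoord, lineEdge, h, Option.map_some, Option.getD_some, dif_pos]
    exact h.choose_spec

theorem lineEmb_injective {L : ι → Option (edgesOver π H B)} (hL : ∃ i, L i = none) :
    Function.Injective (lineEmb π B L) := by
  obtain ⟨i, hi⟩ := hL
  intro x y hxy
  simp only [lineEmb, Prod.mk.injEq] at hxy
  obtain ⟨h₁, h₂, -⟩ := hxy
  have h₃ := congrFun h₂ i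
  rw [h₁] at h₃
  split_ifs at h₃
  · simpa [hi, lineCoord] using h₃
  · exact h₃

theorem lineEmb_coord_active {L : ι → Option (edgesOver π H B)} {i : ι} (hi : L i = none) (x : X) :
    (lineEmb π B L x).2.1 i = x := by
  simp only [lineEmb]
  split_ifs
  · simp [hi, lineCoord]
  · rfl

theorem lineEmb_image_coord {L : ι → Option (edgesOver π H B)} {A : Set X}
    {z : V × (ι → X) × Option (ι → Option (edgesOver π H B))} (hz : z ∈ lineEmb π B L '' A)
    (hzB : z.1 ∈ B) : z.2.2 = none ∧ ∀ i, z.2.1 i ∈ lineEdge (L i) A ∧ π (z.2.1 i) = z.1 := by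
  obtain ⟨x, hx, rfl⟩ := hz
  have hxB : π x ∈ B := hzB
  simp only [lineEmb, hxB, if_true, true_and]
  exact fun i => lineCoord_spec (L i) hx hxB

theorem lineEmb_tag {L : ι → Option (edgesOver π H B)} {A : Set X}
    {z : V × (ι → X) × Option (ι → Option (edgesOver π H B))} (hz : z ∈ lineEmb π B L '' A)
    (hzB : z.1 ∉ B) : z.2.2 = some L := by
  obtain ⟨x, hx, rfl⟩ := hz
  have hxB : π x ∉ B := hzB
  simp [lineEmb, hxB]

theorem mem_lineEmb_image (hP : IsPartiteSystem r s t π H)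
    {L : ι → Option (edgesOver π H B)} (hL : ∃ i, L i = none) {A : Set X} (hA : A ∈ H)
    {z : V × (ι → X) × Option (ι → Option (edgesOver π H B))} (hzB : z.1 ∈ B)
    (htag : z.2.2 = none) (hz : ∀ i, z.2.1 i ∈ lineEdge (L i) A ∧ π (z.2.1 i) = z.1) :
    z ∈ lineEmb π B L '' A := by
  obtain ⟨i₀, hi₀⟩ := hL
  have h₀ := hz i₀
  have hx : z.2.1 i₀ ∈ A := by simpa [hi₀, lineEdge] using h₀.1
  refine ⟨z.2.1 i₀, hx, ?_⟩
  have hB : π (z.2.1 i₀) ∈ B := by rw [h₀.2]; exact hzB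
  refine Prod.ext h₀.2 (Prod.ext ?_ ?_)
  · simp only [lineEmb, hB, if_true]
    funext i
    have h₁ := lineCoord_spec (L i) hx hB
    exact hP.injOn _ (lineEdge_mem (L i) hA) h₁.1 (hz i).1 (by rw [h₁.2, h₀.2, (hz i).2])
  · simp [lineEmb, hB, htag]

theorem lineEmb_fst_injOn (hP : IsPartiteSystem r s t π H)
    {L : ι → Option (edgesOver π H B)} {A : Set X} (hA : A ∈ H) :
    Set.InjOn Prod.fst (lineEmb π B L '' A) := by
  rintro _ ⟨x, hx, rfl⟩ _ ⟨y, hy, rfl⟩ h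
  rw [hP.injOn A hA hx hy h]

theorem lineEdge_eq_of_subset (hP : IsPartiteSystem r s t π H)
    {L M : ι → Option (edgesOver π H B)} {A A' : Set X} (hA : A ∈ H) (hA' : A' ∈ H)
    {S : Set (V × (ι → X) × Option (ι → Option (edgesOver π H B)))} (hS : S.ncard = r)
    (hSB : ∀ z ∈ S, z.1 ∈ B) (h : S ⊆ lineEmb π B L '' A) (h' : S ⊆ lineEmb π B M '' A') (i : ι) :
    lineEdge (L i) A = lineEdge (M i) A' := by
  refine hP.linear _ (lineEdge_mem _ hA) _ (lineEdge_mem _ hA') ((fun z => z.2.1 i) '' S) ?_ ?_ ?_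
  · rw [Set.InjOn.ncard_image, hS]
    intro z hz w hw hzw
    refine lineEmb_fst_injOn hP hA (h hz) (h hw) ?_
    rw [← ((lineEmb_image_coord (h hz) (hSB z hz)).2 i).2,
      ← ((lineEmb_image_coord (h hw) (hSB w hw)).2 i).2]
    exact congrArg π hzw
  · rintro _ ⟨z, hz, rfl⟩
    exact ((lineEmb_image_coord (h hz) (hSB z hz)).2 i).1
  · rintro _ ⟨z, hz, rfl⟩
    exact ((lineEmb_image_coord (h' hz) (hSB z hz)).2 i).1

theorem lineEmb_image_subset (hP : IsPartiteSystem r s t π H)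
    {L M : ι → Option (edgesOver π H B)} (hLM : L ≠ M) (hM : ∃ i, M i = none)
    {A A' : Set X} (hA' : A' ∈ H) (hL : ∃ i, L i = none)
    (h : ∀ i, lineEdge (L i) A = lineEdge (M i) A') :
    lineEmb π B L '' A ⊆ lineEmb π B M '' A' := by
  have hover : π '' A = B := by
    obtain ⟨i, hi⟩ := Function.ne_iff.mp hLM
    have hwi := h i
    rcases hl : L i with _ | ⟨C, hC⟩ <;> rcases hm : M i with _ | ⟨D, hD⟩ <;>
      simp only [hl, hm, lineEdge, Option.map_none, Option.map_some, Option.getD_none,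
        Option.getD_some] at hwi
    · exact absurd (hl.trans hm.symm) hi
    · rw [hwi]
      exact hD.2
    · obtain ⟨j, hj⟩ := hL
      have hwj := h j
      rcases hmj : M j with _ | ⟨E, hE⟩ <;>
        simp only [hj, hmj, lineEdge, Option.map_none, Option.map_some, Option.getD_none,
          Option.getD_some] at hwj
      · rw [hwj, ← hwi]
        exact hC.2
      · rw [hwj]
        exact hE.2
    · subst hwi
      exact absurd (hl.trans hm.symm) hi
  intro z hz
  have hzB : z.1 ∈ B := by
    obtain ⟨x, hx, rfl⟩ := hz
    exact hover.subset ⟨x, hx, rfl⟩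
  obtain ⟨htag, hco⟩ := lineEmb_image_coord hz hzB
  exact mem_lineEmb_image hP hM hA' hzB htag fun i => ⟨h i ▸ (hco i).1, (hco i).2⟩

/-- The hyperedges of the partite amalgam: the images of hyperedges along all lines. -/
def amalgam (ι : Type) (π : X → V) (H : Set (Set X)) (B : Set V) :
    Set (Set (V × (ι → X) × Option (ι → Option (edgesOver π H B)))) :=
  {E | ∃ L : ι → Option (edgesOver π H B), (∃ i, L i = none) ∧ ∃ A ∈ H, E = lineEmb π B L '' A}

theorem amalgam_isPartiteSystem (hr : 2 ≤ r) (hrt : r ≤ t) (hP : IsPartiteSystem r s t π H) :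
    IsPartiteSystem r s t Prod.fst (amalgam ι π H B) where
  injOn := by
    rintro _ ⟨L, hL, A, hA, rfl⟩
    exact lineEmb_fst_injOn hP hA
  card := by
    rintro _ ⟨L, hL, A, hA, rfl⟩
    rw [Set.ncard_image_of_injective _ (lineEmb_injective hL), hP.card A hA]
  linear := by
    rintro _ ⟨L, hL, A, hA, rfl⟩ _ ⟨M, hM, A', hA', rfl⟩ S hS h h'
    by_cases hLM : L = M
    · subst hLM
      obtain ⟨S₀, hS₀, rfl⟩ := Set.subset_image_iff.mp h
      rw [Set.ncard_image_of_injective _ (lineEmb_injective hL)] at hS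
      rw [Set.image_subset_image_iff (lineEmb_injective hL)] at h'
      rw [hP.linear A hA A' hA' S₀ hS hS₀ h']
    · have hSB : ∀ z ∈ S, z.1 ∈ B := by
        intro z hz
        by_contra hzB
        have h₁ := (lineEmb_tag (h hz) hzB).symm.trans (lineEmb_tag (h' hz) hzB)
        exact hLM (Option.some_injective _ h₁)
      have hw := lineEdge_eq_of_subset hP hA hA' hS hSB h h'
      exact (lineEmb_image_subset hP hLM hM hA' hL hw).antisymm
        (lineEmb_image_subset hP (Ne.symm hLM) hL hA hM fun i => (hw i).symm)
  conformal := by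
    intro W hW hcov
    have hpair : ∀ z ∈ W, ∀ w ∈ W, ∃ L : ι → Option (edgesOver π H B), (∃ i, L i = none) ∧
        ∃ A ∈ H, z ∈ lineEmb π B L '' A ∧ w ∈ lineEmb π B L '' A := by
      intro z hz w hw
      obtain ⟨S, hzS, hSW, hS⟩ := Set.exists_subsuperset_card_eq
        (Set.insert_subset hz (Set.singleton_subset_iff.mpr hw))
        ((Set.ncard_insert_le z {w}).trans (by simpa using hr)) (hrt.trans hW)
      obtain ⟨_, ⟨L, hL, A, hA, rfl⟩, hSA⟩ := hcov S hSW hS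
      exact ⟨L, hL, A, hA, hSA (hzS (by simp)), hSA (hzS (by simp))⟩
    by_cases hex : ∃ z ∈ W, z.1 ∉ B
    · obtain ⟨z, hz, hzB⟩ := hex
      obtain ⟨L, hL, A₀, -, hzL, -⟩ := hpair z hz z hz
      have hrange : W ⊆ Set.range (lineEmb π B L) := by
        intro w hw
        obtain ⟨M, -, A, -, hzM, x, -, hx⟩ := hpair z hz w hw
        have h₁ := (lineEmb_tag hzL hzB).symm.trans (lineEmb_tag hzM hzB)
        rw [Option.some_injective _ h₁]
        exact ⟨x, hx⟩
      rw [← Set.image_univ, Set.subset_image_iff] at hrange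
      obtain ⟨W₀, -, rfl⟩ := hrange
      rw [Set.ncard_image_of_injective _ (lineEmb_injective hL)] at hW
      obtain ⟨A, hA, hWA⟩ := hP.conformal W₀ hW (by
        intro S₀ hS₀ hcard
        obtain ⟨_, ⟨M, hM, A, hA, rfl⟩, hSA⟩ := hcov (lineEmb π B L '' S₀) (Set.image_mono hS₀)
          (by rw [Set.ncard_image_of_injective _ (lineEmb_injective hL), hcard])
        by_cases hLM : L = M
        · subst hLM
          exact ⟨A, hA, (Set.image_subset_image_iff (lineEmb_injective hL)).mp hSA⟩
        · obtain ⟨i, hi⟩ := hL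
          refine ⟨lineEdge (M i) A, lineEdge_mem _ hA, fun x hx => ?_⟩
          have hxM := hSA ⟨x, hx, rfl⟩
          have hxB : (lineEmb π B L x).1 ∈ B := by
            by_contra hxB
            have h₁ := (lineEmb_tag (Set.mem_image_of_mem _ hx) hxB).symm.trans
              (lineEmb_tag hxM hxB)
            exact hLM (Option.some_injective _ h₁)
          have h₂ := ((lineEmb_image_coord hxM hxB).2 i).1
          rwa [lineEmb_coord_active hi] at h₂)
      exact ⟨_, ⟨L, hL, A, hA, rfl⟩, Set.image_mono hWA⟩
    · push Not at hex
      obtain ⟨S, hSW, hS⟩ := Set.exists_subset_card_eq (hrt.trans hW)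
      obtain ⟨_, ⟨M, hM, A, hA, rfl⟩, hSA⟩ := hcov S hSW hS
      refine ⟨_, ⟨M, hM, A, hA, rfl⟩, ?_⟩
      have hπ : ∀ z ∈ W, ∀ i, π (z.2.1 i) = z.1 := by
        intro z hz i
        obtain ⟨L, -, A', -, hzL, -⟩ := hpair z hz z hz
        exact ((lineEmb_image_coord hzL (hex z hz)).2 i).2
      have hinj : ∀ i, Set.InjOn (fun z => z.2.1 i) W := by
        intro i z hz w hw hzw
        obtain ⟨L, -, A', hA', hzL, hwL⟩ := hpair z hz w hw
        refine lineEmb_fst_injOn hP hA' hzL hwL ?_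
        rw [← hπ z hz i, ← hπ w hw i]
        exact congrArg π hzw
      have hedge : ∀ i, (fun z => z.2.1 i) '' W ⊆ lineEdge (M i) A := by
        intro i
        obtain ⟨C, hC, hWC⟩ := hP.conformal ((fun z => z.2.1 i) '' W)
          (by rwa [(hinj i).ncard_image]) (by
            intro T hT hcard
            obtain ⟨T₀, hT₀, rfl⟩ := Set.subset_image_iff.mp hT
            rw [((hinj i).mono hT₀).ncard_image] at hcard
            obtain ⟨_, ⟨L, hL, A', hA', rfl⟩, hTA⟩ := hcov T₀ hT₀ hcard
            refine ⟨lineEdge (L i) A', lineEdge_mem _ hA', ?_⟩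
            rintro _ ⟨z, hz, rfl⟩
            exact ((lineEmb_image_coord (hTA hz) (hex z (hT₀ hz))).2 i).1)
        have hCM : C = lineEdge (M i) A := by
          refine hP.linear C hC _ (lineEdge_mem _ hA) ((fun z => z.2.1 i) '' S) ?_
            ((Set.image_mono hSW).trans hWC) ?_
          · rw [((hinj i).mono hSW).ncard_image, hS]
          · rintro _ ⟨z, hz, rfl⟩
            exact ((lineEmb_image_coord (hSA hz) (hex z (hSW hz))).2 i).1
        rwa [← hCM]
      intro z hz
      obtain ⟨L, -, A', -, hzL, -⟩ := hpair z hz z hz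
      exact mem_lineEmb_image hP hM hA (hex z hz) (lineEmb_image_coord hzL (hex z hz)).1
        fun i => ⟨hedge i ⟨z, hz, rfl⟩, hπ z hz i⟩

/-- The partite construction step: passing to an amalgam, every coloring of the hyperedges admits
a copy of the original system in which all hyperedges over `B` have the same color. -/
theorem exists_partite_step [Finite X] [Finite V] (hr : 2 ≤ r) (hrt : r ≤ t)
    (hP : IsPartiteSystem r s t π H) (B : Set V) (κ : Type) [Finite κ] :
    ∃ (Y : Type) (_ : Finite Y) (ρ : Y → V) (K : Set (Set Y)), IsPartiteSystem r s t ρ K ∧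
      ∀ c : Set Y → κ, ∃ ψ : X → Y, Function.Injective ψ ∧ (∀ x, ρ (ψ x) = π x) ∧
        (∀ A ∈ H, ψ '' A ∈ K) ∧
        ∀ A ∈ H, ∀ A' ∈ H, π '' A = B → π '' A' = B → c (ψ '' A) = c (ψ '' A') := by
  obtain ⟨ι, _, hHJ⟩ :=
    Combinatorics.Line.exists_mono_in_high_dimension (edgesOver π H B) κ
  refine ⟨V × (ι → X) × Option (ι → Option (edgesOver π H B)), inferInstance, Prod.fst,
    amalgam ι π H B, amalgam_isPartiteSystem hr hrt hP, fun c => ?_⟩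
  obtain ⟨l, k, hl⟩ := hHJ fun w =>
    c {z | z.1 ∈ B ∧ z.2.2 = none ∧ ∀ i, z.2.1 i ∈ (w i).1 ∧ π (z.2.1 i) = z.1}
  have hcolor : ∀ A ∈ H, π '' A = B → c (lineEmb π B l.idxFun '' A) = k := by
    intro A hA hAB
    rw [← hl ⟨A, hA, hAB⟩]
    congr 1
    have hw : ∀ i, (l ⟨A, hA, hAB⟩ i).1 = lineEdge (l.idxFun i) A := by
      intro i
      rw [Combinatorics.Line.apply_def]
      rcases h : l.idxFun i with _ | C <;> simp [h, lineEdge]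
    ext z
    simp only [Set.mem_ofPred_eq, hw]
    refine ⟨fun hz => ?_, fun hz => mem_lineEmb_image hP l.proper hA hz.1 hz.2.1 hz.2.2⟩
    have hzB : z.1 ∈ B := by
      obtain ⟨x, hx, rfl⟩ := hz
      exact hAB.subset ⟨x, hx, rfl⟩
    exact ⟨hzB, lineEmb_image_coord hz hzB⟩
  exact ⟨lineEmb π B l.idxFun, lineEmb_injective l.proper, fun x => rfl,
    fun A hA => ⟨l.idxFun, l.proper, A, hA, rfl⟩,
    fun A hA A' hA' h h' => (hcolor A hA h).trans (hcolor A' hA' h').symm⟩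

end PartiteStep

/-- The partite construction: for every system there is another one such that every coloring of
its hyperedges admits a copy of the given system in which the color of a hyperedge depends only
on its projection. -/
theorem exists_partite_construction {X V : Type} [Finite X] [Finite V] {r s t : ℕ} {π : X → V}
    {H : Set (Set X)} (hr : 2 ≤ r) (hrt : r ≤ t) (hP : IsPartiteSystem r s t π H)
    (κ : Type) [Finite κ] :
    ∃ (Y : Type) (_ : Finite Y) (ρ : Y → V) (K : Set (Set Y)), IsPartiteSystem r s t ρ K ∧
      ∀ c : Set Y → κ, ∃ ψ : X → Y, Function.Injective ψ ∧ (∀ x, ρ (ψ x) = π x) ∧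
        (∀ A ∈ H, ψ '' A ∈ K) ∧
        ∀ A ∈ H, ∀ A' ∈ H, π '' A = π '' A' → c (ψ '' A) = c (ψ '' A') := by
  suffices h : ∀ 𝓑 : Set (Set V), 𝓑.Finite →
      ∃ (Y : Type) (_ : Finite Y) (ρ : Y → V) (K : Set (Set Y)), IsPartiteSystem r s t ρ K ∧
        ∀ c : Set Y → κ, ∃ ψ : X → Y, Function.Injective ψ ∧ (∀ x, ρ (ψ x) = π x) ∧
          (∀ A ∈ H, ψ '' A ∈ K) ∧
          ∀ B ∈ 𝓑, ∀ A ∈ H, ∀ A' ∈ H, π '' A = B → π '' A' = B → c (ψ '' A) = c (ψ '' A') by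
    obtain ⟨Y, hY, ρ, K, hK, h⟩ := h Set.univ Set.finite_univ
    refine ⟨Y, hY, ρ, K, hK, fun c => ?_⟩
    obtain ⟨ψ, h₁, h₂, h₃, h₄⟩ := h c
    exact ⟨ψ, h₁, h₂, h₃, fun A hA A' hA' hAA' =>
      h₄ (π '' A') (Set.mem_univ _) A hA A' hA' hAA' rfl⟩
  intro 𝓑 h𝓑
  induction 𝓑, h𝓑 using Set.Finite.induction_on with
  | empty =>
    exact ⟨X, inferInstance, π, H, hP, fun c => ⟨id, Function.injective_id, fun _ => rfl,
      fun A hA => by simpa using hA, by simp⟩⟩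
  | @insert B 𝓑 _ _ ih =>
    obtain ⟨Y, _, ρ, K, hK, h⟩ := ih
    obtain ⟨Z, hZ, σ, L, hL, h'⟩ := exists_partite_step hr hrt hK B κ
    refine ⟨Z, hZ, σ, L, hL, fun c => ?_⟩
    obtain ⟨χ, hχ, hχπ, hχL, hχc⟩ := h' c
    obtain ⟨ψ, hψ, hψπ, hψK, hψc⟩ := h fun E => c (χ '' E)
    have hover : ∀ A, ρ '' (ψ '' A) = π '' A := by
      intro A
      rw [Set.image_image]
      simp only [hψπ]
    refine ⟨χ ∘ ψ, hχ.comp hψ, fun x => by simp [hχπ, hψπ], fun A hA => ?_, ?_⟩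
    · rw [Set.image_comp]
      exact hχL _ (hψK A hA)
    · rintro C hC A hA A' hA' hAC hAC'
      rw [Set.image_comp, Set.image_comp]
      rcases hC with rfl | hC
      · exact hχc _ (hψK A hA) _ (hψK A' hA') (by rw [hover, hAC]) (by rw [hover, hAC'])
      · exact hψc C hC A hA A' hA' hAC hAC'

/-- Vertices of the initial picture: copies of `U` indexed by a placement `U → V` and by a choice
of a set for every edge, with additional vertices for every edge. -/
abbrev PictureVertex (U V : Type) : Type := (U → V) × (Set U → Set V) × (U ⊕ Set U × V)

/-- The projection of the initial picture. -/
def pictureProj {U V : Type} (z : PictureVertex U V) : V :=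
  Sum.elim z.1 Prod.snd z.2.2

/-- The hyperedge of the initial picture extending the copy of `e` to one lying over `A e`. -/
def pictureEdge {U V : Type} (φ : U → V) (A : Set U → Set V) (e : Set U) :
    Set (PictureVertex U V) :=
  {z | z.1 = φ ∧ z.2.1 = A ∧
    Sum.elim (fun u => u ∈ e) (fun p => p.1 = e ∧ p.2 ∈ A e ∧ p.2 ∉ φ '' e) z.2.2}

/-- The hyperedges of the initial picture. -/
def pictureEdges {U V : Type} (s : ℕ) (F : Set (Set U)) : Set (Set (PictureVertex U V)) :=
  {E | ∃ φ : U → V, ∃ A : Set U → Set V, ∃ e ∈ F, Function.Injective φ ∧ φ '' e ⊆ A e ∧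
    (A e).ncard = s ∧ E = pictureEdge φ A e}

theorem pictureProj_injOn {U V : Type} {φ : U → V} (hφ : Function.Injective φ)
    (A : Set U → Set V) (e : Set U) : Set.InjOn pictureProj (pictureEdge φ A e) := by
  rintro ⟨_, _, u | ⟨e₁, b⟩⟩ ⟨rfl, rfl, hz⟩ ⟨_, _, v | ⟨e₂, d⟩⟩ ⟨rfl, rfl, hw⟩ h
  · rw [hφ h]
  · exact absurd ⟨u, hz, h⟩ hw.2.2
  · exact absurd ⟨v, hw, h.symm⟩ hz.2.2
  · obtain ⟨rfl, -⟩ := hz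
    obtain ⟨rfl, -⟩ := hw
    obtain rfl : b = d := h
    rfl

theorem pictureProj_image {U V : Type} {φ : U → V} {A : Set U → Set V} {e : Set U}
    (h : φ '' e ⊆ A e) : pictureProj '' pictureEdge φ A e = A e := by
  ext b
  constructor
  · rintro ⟨⟨_, _, u | ⟨e₁, b⟩⟩, ⟨rfl, rfl, hz⟩, rfl⟩
    · exact h ⟨u, hz, rfl⟩
    · exact hz.2.1
  · intro hb
    by_cases hbe : b ∈ φ '' e
    · obtain ⟨u, hu, rfl⟩ := hbe
      exact ⟨(φ, A, Sum.inl u), ⟨rfl, rfl, hu⟩, rfl⟩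
    · exact ⟨(φ, A, Sum.inr (e, b)), ⟨rfl, rfl, rfl, hb, hbe⟩, rfl⟩

theorem picture_isPartiteSystem {U V : Type} [Finite U] {r s t : ℕ} (hr : 2 ≤ r) (hrt : r ≤ t)
    {F : Set (Set U)} (hF : ∀ e ∈ F, e.ncard = r)
    (hfree : ∀ W : Set U, t ≤ W.ncard → ∃ S ⊆ W, S.ncard = r ∧ S ∉ F) :
    IsPartiteSystem r s t (pictureProj (U := U) (V := V)) (pictureEdges s F) where
  injOn := by
    rintro _ ⟨φ, A, e, -, hφ, -, -, rfl⟩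
    exact pictureProj_injOn hφ A e
  card := by
    rintro _ ⟨φ, A, e, -, hφ, hA, hs, rfl⟩
    rw [← (pictureProj_injOn hφ A e).ncard_image, pictureProj_image hA, hs]
  linear := by
    rintro _ ⟨φ, A, e, he, hφ, -, -, rfl⟩ _ ⟨φ', A', e', he', -, -, -, rfl⟩ S hS h h'
    obtain ⟨z, hz⟩ : S.Nonempty := Set.nonempty_of_ncard_ne_zero (by omega)
    obtain rfl : φ = φ' := (h hz).1.symm.trans (h' hz).1
    obtain rfl : A = A' := (h hz).2.1.symm.trans (h' hz).2.1
    suffices hee : e = e' by rw [hee]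
    by_cases hex : ∃ w ∈ S, ∃ p, w.2.2 = Sum.inr p
    · obtain ⟨w, hw, p, hp⟩ := hex
      have h₁ := (h hw).2.2
      have h₂ := (h' hw).2.2
      rw [hp] at h₁ h₂
      exact h₁.1.symm.trans h₂.1
    · push Not at hex
      have himage : S ⊆ (fun u => (φ, A, Sum.inl u)) '' (e ∩ e') := by
        intro w hw
        have h₁ := h hw
        have h₂ := h' hw
        have h₃ := hex w hw
        obtain ⟨a, b, u | p⟩ := w
        · obtain ⟨rfl, rfl, h₁⟩ := h₁
          exact ⟨u, ⟨h₁, h₂.2.2⟩, rfl⟩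
        · exact absurd rfl (h₃ p)
      have hle : r ≤ (e ∩ e').ncard := by
        rw [← hS]
        exact (Set.ncard_le_ncard himage (Set.toFinite _)).trans
          (Set.ncard_image_le (Set.toFinite _))
      have h₁ : e ∩ e' = e :=
        Set.eq_of_subset_of_ncard_le Set.inter_subset_left (by rw [hF e he]; exact hle)
          (Set.toFinite _)
      have h₂ : e ∩ e' = e' :=
        Set.eq_of_subset_of_ncard_le Set.inter_subset_right (by rw [hF e' he']; exact hle)
          (Set.toFinite _)
      exact h₁.symm.trans h₂
  conformal := by
    intro W hW hcov
    have hpair : ∀ z ∈ W, ∀ w ∈ W, ∃ E ∈ pictureEdges s F, z ∈ E ∧ w ∈ E := by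
      intro z hz w hw
      obtain ⟨S, hzS, hSW, hS⟩ := Set.exists_subsuperset_card_eq
        (Set.insert_subset hz (Set.singleton_subset_iff.mpr hw))
        ((Set.ncard_insert_le z {w}).trans (by simpa using hr)) (hrt.trans hW)
      obtain ⟨E, hE, hSE⟩ := hcov S hSW hS
      exact ⟨E, hE, hSE (hzS (by simp)), hSE (hzS (by simp))⟩
    by_cases hex : ∃ z ∈ W, ∃ p, z.2.2 = Sum.inr p
    · obtain ⟨⟨φ, A, _⟩, hz, p, rfl⟩ := hex
      obtain ⟨_, ⟨_, _, e, he, hφ, hA, hs, rfl⟩, ⟨rfl, rfl, hp⟩, -⟩ := hpair _ hz _ hz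
      refine ⟨_, ⟨_, _, e, he, hφ, hA, hs, rfl⟩, fun w hw => ?_⟩
      obtain ⟨_, ⟨_, _, e', he', -, -, -, rfl⟩, ⟨rfl, rfl, hp'⟩, hw'⟩ := hpair _ hz w hw
      obtain rfl : e = e' := hp.1.symm.trans hp'.1
      exact hw'
    · push Not at hex
      exfalso
      obtain ⟨⟨φ, A, y⟩, hz⟩ : W.Nonempty := Set.nonempty_of_ncard_ne_zero (by omega)
      have hinj : Function.Injective fun u : U => ((φ, A, Sum.inl u) : PictureVertex U V) :=
        fun u v huv => by simpa using huv
      have hrange : W ⊆ (fun u => (φ, A, Sum.inl u)) '' Set.univ := by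
        intro w hw
        obtain ⟨_, ⟨_, _, e', he', -, -, -, rfl⟩, ⟨rfl, rfl, -⟩, hw'⟩ := hpair _ hz w hw
        have h₃ := hex w hw
        obtain ⟨a, b, u | p⟩ := w
        · obtain ⟨rfl, rfl, -⟩ := hw'
          exact ⟨u, trivial, rfl⟩
        · exact absurd rfl (h₃ p)
      obtain ⟨W₀, -, rfl⟩ := Set.subset_image_iff.mp hrange
      rw [Set.ncard_image_of_injective _ hinj] at hW
      obtain ⟨S, hSW, hS, hSF⟩ := hfree W₀ hW
      obtain ⟨_, ⟨φ', A', e, he, -, -, -, rfl⟩, hSE⟩ := hcov _ (Set.image_mono hSW)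
        (by rw [Set.ncard_image_of_injective _ hinj, hS])
      have hSe : S ⊆ e := fun u hu => (hSE ⟨u, hu, rfl⟩).2.2
      have := Set.eq_of_subset_of_ncard_le hSe (by rw [hF e he, hS]) (Set.toFinite _)
      exact hSF (this ▸ he)

/-- For an `r`-graph `F` without a clique on `t` vertices there is an `r`-linear, conformal
`s`-graph such that every choice of an `r`-subset from each hyperedge produces a copy of `F`. -/
theorem exists_conformal_linear_selection {U : Type} [Finite U] {r s t : ℕ} (hr : 2 ≤ r)
    (hrt : r ≤ t) (hrs : r ≤ s) {F : Set (Set U)} (hF : ∀ e ∈ F, e.ncard = r)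
    (hfree : ∀ W : Set U, t ≤ W.ncard → ∃ S ⊆ W, S.ncard = r ∧ S ∉ F) :
    ∃ (Y : Type) (_ : Finite Y) (V : Type) (ρ : Y → V) (K : Set (Set Y)),
      IsPartiteSystem r s t ρ K ∧
      ∀ f : Set Y → Set Y, (∀ E ∈ K, f E ⊆ E ∧ (f E).ncard = r) →
        ∃ ψ : U → Y, Function.Injective ψ ∧ ∀ e ∈ F, ∃ E ∈ K, f E = ψ '' e := by
  obtain ⟨N, hN⟩ := exists_ramsey_bound r s (Nat.card U)
  have hpic := picture_isPartiteSystem (V := Fin N) (s := s) hr hrt hF hfree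
  obtain ⟨Y, hY, ρ, K, hK, hc⟩ := exists_partite_construction hr hrt hpic (Set (Fin N))
  refine ⟨Y, hY, Fin N, ρ, K, hK, fun f hf => ?_⟩
  obtain ⟨ψ, hψ, hψρ, hψK, hψc⟩ := hc fun E => ρ '' f E
  have hover : ∀ E, ρ '' (ψ '' E) = pictureProj '' E := by
    intro E
    rw [Set.image_image]
    simp only [hψρ]
  have hγ : ∀ B : Set (Fin N), B.ncard = s → ∃ D ⊆ B, D.ncard = r ∧
      ∀ E ∈ pictureEdges s F, pictureProj '' E = B → ρ '' f (ψ '' E) = D := by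
    intro B hB
    by_cases hex : ∃ E ∈ pictureEdges s F, pictureProj '' E = B
    · obtain ⟨E, hE, rfl⟩ := hex
      have hfE := hf _ (hψK E hE)
      refine ⟨ρ '' f (ψ '' E), ?_, ?_, fun E' hE' h => hψc E' hE' E hE h⟩
      · rw [← hover]
        exact Set.image_mono hfE.1
      · rw [((hK.injOn _ (hψK E hE)).mono hfE.1).ncard_image, hfE.2]
    · push Not at hex
      obtain ⟨D, hD, hDr⟩ := Set.exists_subset_card_eq (hrs.trans hB.ge)
      exact ⟨D, hD, hDr, fun E hE h => absurd h (hex E hE)⟩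
  choose γ hγB hγr hγE using hγ
  rcases hN (Fin N) Finset.univ
      (fun e => ¬ ∃ B : Set (Fin N), ∃ h : B.ncard = s, γ B h = ↑e) (by simp) with
    ⟨B, -, hB, hred⟩ | ⟨B, -, hB, hblue⟩
  · have hBs : (B : Set (Fin N)).ncard = s := by rw [Set.ncard_coe_finset, hB]
    refine absurd ⟨_, hBs, ?_⟩ (hred (γ B hBs).toFinite.toFinset ?_ ?_)
    · intro x hx
      exact_mod_cast hγB B hBs (by simpa using hx)
    · rw [← Set.ncard_eq_toFinset_card, hγr]
    · simp
  · obtain ⟨φ⟩ : Nonempty (U ≃ B) := Finite.card_eq.mp (by simp [hB])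
    set φ' : U → Fin N := fun u => (φ u : Fin N)
    have hφinj : Function.Injective φ' := Subtype.val_injective.comp φ.injective
    have hA : ∀ e : Set U, ∃ A : Set (Fin N), e ∈ F → ∃ h : A.ncard = s, γ A h = φ' '' e := by
      intro e
      by_cases he : e ∈ F
      · have := hblue (φ' '' e).toFinite.toFinset (by
          intro x hx
          obtain ⟨u, -, rfl⟩ : x ∈ φ' '' e := by simpa using hx
          exact (φ u).2) (by
          rw [← Set.ncard_eq_toFinset_card, Set.ncard_image_of_injective _ hφinj, hF e he])
        rw [not_not] at this
        obtain ⟨A, h, hA⟩ := this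
        exact ⟨A, fun _ => ⟨h, by simpa using hA⟩⟩
      · exact ⟨∅, fun h => absurd h he⟩
    choose A hA using hA
    refine ⟨fun u => ψ (φ', A, Sum.inl u), fun u v huv => by simpa using hψ huv, fun e he => ?_⟩
    obtain ⟨hs, hAe⟩ := hA e he
    have hsub : φ' '' e ⊆ A e := hAe ▸ hγB _ hs
    have hE : pictureEdge φ' A e ∈ pictureEdges s F := ⟨φ', A, e, he, hφinj, hsub, hs, rfl⟩
    refine ⟨_, hψK _ hE, ?_⟩
    have hfE := hf _ (hψK _ hE)
    have hsub' : (fun u => ψ (φ', A, Sum.inl u)) '' e ⊆ ψ '' pictureEdge φ' A e := by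
      rintro _ ⟨u, hu, rfl⟩
      exact ⟨(φ', A, Sum.inl u), ⟨rfl, rfl, hu⟩, rfl⟩
    refine ((hK.injOn _ (hψK _ hE)).image_eq_image_iff hfE.1 hsub').mp ?_
    rw [hγE _ hs _ hE (pictureProj_image hsub), hAe, Set.image_image]
    simp only [hψρ]
    rfl

theorem mDensity_completeHG_le {r t : ℕ} (hr : 2 ≤ r) (hrt : r < t) {F : HGraph r}
    {W : Finset ℕ} (hW : W ⊆ F.verts) (hcard : W.card = t)
    (hclique : ∀ e ⊆ W, e.card = r → e ∈ F.edges) :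
    mDensity r (completeHG r t) ≤ mDensity r F := by
  have hchoose : 2 ≤ t.choose r := by
    calc 2 ≤ r + 1 := by omega
      _ = (r + 1).choose r := (Nat.choose_succ_self_right r).symm
      _ ≤ t.choose r := Nat.choose_le_choose r hrt
  have hK : 2 ≤ (completeHG r t).edges.card := by
    simpa [completeHG] using hchoose
  have hFc : 2 ≤ F.edges.card := by
    refine hchoose.trans ?_
    rw [← hcard, ← Finset.card_powersetCard]
    refine Finset.card_le_card fun e he => ?_
    rw [Finset.mem_powersetCard] at he
    exact hclique e he.1 he.2
  rw [mDensity, mDensity, if_neg (by omega), if_neg (by omega), if_neg (by omega),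
    if_neg (by omega)]
  refine csSup_le_csSup ?_ ?_ ?_
  · refine ⟨F.edges.card, ?_⟩
    rintro x ⟨J, hJ, hv, rfl⟩
    have h₁ : (1 : ℝ) ≤ (J.verts.card : ℝ) - r := by
      have : (r : ℝ) + 1 ≤ J.verts.card := by exact_mod_cast hv
      linarith
    have h₂ : (J.edges.card : ℝ) ≤ F.edges.card := by exact_mod_cast Finset.card_le_card hJ.2
    rw [div_le_iff₀ (by linarith)]
    nlinarith [Nat.cast_nonneg (α := ℝ) F.edges.card]
  · exact ⟨_, completeHG r t, ⟨Finset.Subset.refl _, Finset.Subset.refl _⟩,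
      by simpa [completeHG] using hrt, rfl⟩
  · rintro x ⟨J, hJ, hv, rfl⟩
    obtain ⟨g, hgW, hg⟩ := (Finset.finite_toSet (Finset.range t)).exists_injOn_of_encard_le
      (t := (W : Set ℕ)) (by rw [Set.encard_coe_eq_coe_finsetCard,
        Set.encard_coe_eq_coe_finsetCard, hcard, Finset.card_range])
    have hJg : Set.InjOn g J.verts := hg.mono (by exact_mod_cast hJ.1)
    have hcardg : ∀ e ⊆ J.verts, (e.image g).card = e.card := fun e he =>
      Finset.card_image_of_injOn (hJg.mono (by exact_mod_cast he))
    have hsubW : ∀ e ⊆ J.verts, e.image g ⊆ W := by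
      intro e he x hx
      obtain ⟨y, hy, rfl⟩ := Finset.mem_image.mp hx
      exact_mod_cast hgW (by exact_mod_cast hJ.1 (he hy))
    refine ⟨⟨J.verts.image g, J.edges.image (Finset.image g), ?_, ?_⟩, ⟨?_, ?_⟩, ?_, ?_⟩
    · intro e he
      obtain ⟨e', he', rfl⟩ := Finset.mem_image.mp he
      exact Finset.image_subset_image (J.edge_sub e' he')
    · intro e he
      obtain ⟨e', he', rfl⟩ := Finset.mem_image.mp he
      rw [hcardg e' (J.edge_sub e' he'), J.edge_card e' he']
    · exact (hsubW _ (Finset.Subset.refl _)).trans hW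
    · intro e he
      obtain ⟨e', he', rfl⟩ := Finset.mem_image.mp he
      exact hclique _ (hsubW e' (J.edge_sub e' he'))
        (by rw [hcardg e' (J.edge_sub e' he'), J.edge_card e' he'])
    · rwa [hcardg _ (Finset.Subset.refl _)]
    · rw [hcardg _ (Finset.Subset.refl _), Finset.card_image_of_injOn]
      intro e he e' he' h
      have h' : g '' (e : Set ℕ) = g '' (e' : Set ℕ) := by
        rw [← Finset.coe_image, ← Finset.coe_image]
        exact congrArg _ h
      exact_mod_cast (hJg.image_eq_image_iff (by exact_mod_cast J.edge_sub e he)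
        (by exact_mod_cast J.edge_sub e' he')).mp h'

theorem exists_injOn_of_ncard_eq {X Y : Type} [Nonempty Y] {A : Set X} {B : Set Y}
    (hA : A.Finite) (hB : B.Finite) (h : A.ncard = B.ncard) :
    ∃ g : X → Y, Set.InjOn g A ∧ ∀ x ∈ A, g x ∈ B := by
  obtain ⟨g, hgB, hg⟩ := hA.exists_injOn_of_encard_le (t := B)
    (by rw [← hA.cast_ncard_eq, ← hB.cast_ncard_eq, h])
  exact ⟨g, hg, fun x hx => hgB hx⟩

open Classical in
/-- The `r`-graph on `Fin (Nat.card Y)` of all `r`-sets covered by members of `K`. -/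
noncomputable def shadowHG (r : ℕ) {Y : Type} (n : Y → ℕ) (K : Set (Set Y)) : HGraph r where
  verts := Finset.range (Nat.card Y)
  edges := ((Finset.range (Nat.card Y)).powersetCard r).filter
    fun e => ∃ E ∈ K, (e : Set ℕ) ⊆ n '' E
  edge_sub := fun _ he => (Finset.mem_powersetCard.mp (Finset.mem_filter.mp he).1).1
  edge_card := fun _ he => (Finset.mem_powersetCard.mp (Finset.mem_filter.mp he).1).2

theorem mem_shadowHG_edges {r : ℕ} {Y : Type} {n : Y → ℕ} (hn : ∀ y, n y < Nat.card Y)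
    {K : Set (Set Y)} {e : Finset ℕ} :
    e ∈ (shadowHG r n K).edges ↔ e.card = r ∧ ∃ E ∈ K, (e : Set ℕ) ⊆ n '' E := by
  simp only [shadowHG, Finset.mem_filter, Finset.mem_powersetCard]
  refine ⟨fun h => ⟨h.1.2, h.2⟩, fun h => ⟨⟨fun x hx => ?_, h.1⟩, h.2⟩⟩
  obtain ⟨E, -, hE⟩ := h.2
  obtain ⟨y, -, rfl⟩ := hE hx
  exact Finset.mem_range.mpr (hn y)

theorem shadowHG_not_arrowsList {r s t l : ℕ} {Y V : Type} [Finite Y] {ρ : Y → V}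
    {K : Set (Set Y)} (hK : IsPartiteSystem r s t ρ K) {n : Y → ℕ} (hn : Function.Injective n)
    (hlt : ∀ y, n y < Nat.card Y) (q : Fin l → ℕ) (hq : ∀ i, t ≤ q i)
    (hs : ¬ ArrowsList (completeHG r s) l fun i => completeHG r (q i)) :
    ¬ ArrowsList (shadowHG r n K) l fun i => completeHG r (q i) := by
  classical
  simp only [ArrowsList] at hs ⊢
  push Not at hs ⊢
  obtain ⟨c₀, hc₀⟩ := hs
  have hθ : ∀ E : Set Y, ∃ θ : ℕ → ℕ, E ∈ K →
      Set.InjOn θ (n '' E) ∧ ∀ x ∈ n '' E, θ x ∈ (Finset.range s : Set ℕ) := by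
    intro E
    by_cases hE : E ∈ K
    · obtain ⟨θ, h⟩ := exists_injOn_of_ncard_eq (A := n '' E) (B := (Finset.range s : Set ℕ))
        (Set.toFinite _) (Set.toFinite _)
        (by rw [Set.ncard_image_of_injective _ hn, hK.card E hE, Set.ncard_coe_finset,
          Finset.card_range])
      exact ⟨θ, fun _ => h⟩
    · exact ⟨id, fun h => absurd h hE⟩
  choose θ hθ using hθ
  refine ⟨fun e => if h : ∃ E ∈ K, (e : Set ℕ) ⊆ n '' E then c₀ (e.image (θ h.choose)) else c₀ e,
    fun i hcopy => ?_⟩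
  obtain ⟨φ, hφ, hφv, hφe⟩ := hcopy
  have hedge : ∀ e ⊆ Finset.range (q i), e.card = r → e ∈ (completeHG r (q i)).edges :=
    fun e he hc => Finset.mem_powersetCard.mpr ⟨he, hc⟩
  have hrange : ∀ e ⊆ Finset.range (q i), n '' (n ⁻¹' (φ '' e)) = φ '' e := by
    intro e he
    refine Set.image_preimage_eq_of_subset ?_
    rintro _ ⟨v, hv, rfl⟩
    have h := Finset.mem_range.mp (hφv v (he hv))
    have hbij : Function.Bijective fun y => (⟨n y, hlt y⟩ : Fin (Nat.card Y)) := by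
      have := Fintype.ofFinite Y
      rw [Fintype.bijective_iff_injective_and_card]
      exact ⟨fun a b hab => hn (by simpa using hab), by simp [Nat.card_eq_fintype_card]⟩
    obtain ⟨y, hy⟩ := hbij.2 ⟨φ v, h⟩
    exact ⟨y, by simpa using hy⟩
  have hncard : ∀ e ⊆ Finset.range (q i), (n ⁻¹' (φ '' (e : Set ℕ))).ncard = e.card := by
    intro e he
    rw [← Set.ncard_image_of_injective _ hn, hrange e he,
      (hφ.mono (by exact_mod_cast he)).ncard_image, Set.ncard_coe_finset]
  have hcover : ∀ e ⊆ Finset.range (q i), e.card = r →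
      ∃ E ∈ K, ((e.image φ : Finset ℕ) : Set ℕ) ⊆ n '' E := fun e he hc =>
    ((mem_shadowHG_edges hlt).mp (hφe e (hedge e he hc)).1).2
  have hpre : ∀ (e : Finset ℕ) (E : Set Y), ((e.image φ : Finset ℕ) : Set ℕ) ⊆ n '' E →
      n ⁻¹' (φ '' (e : Set ℕ)) ⊆ E := by
    intro e E h y hy
    rw [Finset.coe_image] at h
    obtain ⟨y', hy', h'⟩ := h hy
    rwa [← hn h']
  obtain ⟨E, hE, hWE⟩ := hK.conformal (n ⁻¹' (φ '' (Finset.range (q i) : Set ℕ)))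
    (by rw [hncard _ (Finset.Subset.refl _), Finset.card_range]; exact hq i) (by
      intro S hS hcard
      have hS' : n '' S ⊆ φ '' (Finset.range (q i) : Set ℕ) := by
        rintro _ ⟨y, hy, rfl⟩
        exact hS hy
      obtain ⟨e, he, heS⟩ := Set.subset_image_iff.mp hS'
      lift e to Finset ℕ using (Finset.finite_toSet _).subset he
      have he' : e ⊆ Finset.range (q i) := by exact_mod_cast he
      have hSe : n ⁻¹' (φ '' (e : Set ℕ)) = S := by
        rw [heS, Set.preimage_image_eq _ hn]
      obtain ⟨E, hE, hEe⟩ := hcover e he' (by rw [← hncard e he', hSe, hcard])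
      exact ⟨E, hE, hSe ▸ hpre e E hEe⟩)
  have hφE : ∀ v ∈ Finset.range (q i), φ v ∈ n '' E := by
    intro v hv
    have : φ v ∈ n '' (n ⁻¹' (φ '' (Finset.range (q i) : Set ℕ))) := by
      rw [hrange _ (Finset.Subset.refl _)]
      exact ⟨v, hv, rfl⟩
    exact Set.image_mono hWE this
  refine hc₀ i ⟨θ E ∘ φ, ?_, ?_, ?_⟩
  · exact (hθ E hE).1.comp hφ fun v hv => hφE v hv
  · exact fun v hv => by exact_mod_cast (hθ E hE).2 _ (hφE v hv)
  · intro e he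
    obtain ⟨he₁, he₂⟩ := Finset.mem_powersetCard.mp he
    have hinj : Set.InjOn (θ E ∘ φ) (e : Set ℕ) :=
      ((hθ E hE).1.comp hφ fun v hv => hφE v hv).mono (by exact_mod_cast he₁)
    refine ⟨Finset.mem_powersetCard.mpr ⟨?_, by rw [Finset.card_image_of_injOn hinj, he₂]⟩, ?_⟩
    · intro x hx
      obtain ⟨v, hv, rfl⟩ := Finset.mem_image.mp hx
      exact_mod_cast (hθ E hE).2 _ (hφE v (he₁ hv))
    · have hex := hcover e he₁ he₂
      have hcol := (hφe e he).2
      beta_reduce at hcol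
      rw [dif_pos hex] at hcol
      have hEE : hex.choose = E := hK.linear _ hex.choose_spec.1 E hE
        (n ⁻¹' (φ '' (e : Set ℕ))) (by rw [hncard e he₁, he₂]) (hpre e _ hex.choose_spec.2)
        ((Set.preimage_mono (Set.image_mono (by exact_mod_cast he₁))).trans hWE)
      rwa [hEE, Finset.image_image] at hcol

theorem shadowHG_arrows2 {r s t : ℕ} {Y V : Type} [Finite Y] {ρ : Y → V}
    {K : Set (Set Y)} (hK : IsPartiteSystem r s t ρ K) {n : Y → ℕ} (hn : Function.Injective n)
    (hlt : ∀ y, n y < Nat.card Y) {F : HGraph r}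
    (hsel : ∀ f : Set Y → Set Y, (∀ E ∈ K, f E ⊆ E ∧ (f E).ncard = r) →
      ∃ ψ : F.verts → Y, Function.Injective ψ ∧
        ∀ e ∈ F.edges, ∃ E ∈ K, f E = ψ '' (Subtype.val ⁻¹' (e : Set ℕ))) :
    Arrows2 (shadowHG r n K) (completeHG r s) F := by
  classical
  intro c
  by_cases hred : HasCopyWith (completeHG r s) (shadowHG r n K) fun e => c e = true
  · exact Or.inl hred
  right
  have hf : ∀ E : Set Y, ∃ S : Set Y, E ∈ K → (S ⊆ E ∧ S.ncard = r) ∧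
      ∀ e : Finset ℕ, (e : Set ℕ) = n '' S → c e = false := by
    intro E
    by_cases hE : E ∈ K
    swap
    · exact ⟨∅, fun h => absurd h hE⟩
    by_contra! hall
    obtain ⟨φ, hφ, hφE⟩ := exists_injOn_of_ncard_eq (A := (Finset.range s : Set ℕ))
      (B := n '' E) (Set.toFinite _) (Set.toFinite _)
      (by rw [Set.ncard_image_of_injective _ hn, hK.card E hE, Set.ncard_coe_finset,
        Finset.card_range])
    refine hred ⟨φ, hφ, ?_, ?_⟩
    · intro v hv
      obtain ⟨y, -, hy⟩ := hφE v hv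
      rw [← hy]
      exact Finset.mem_range.mpr (hlt y)
    · intro e he
      obtain ⟨he₁, he₂⟩ := Finset.mem_powersetCard.mp he
      have hsub : ((e.image φ : Finset ℕ) : Set ℕ) ⊆ n '' E := by
        intro x hx
        obtain ⟨v, hv, rfl⟩ := Finset.mem_image.mp hx
        exact hφE v (by exact_mod_cast he₁ hv)
      have hcard : (e.image φ).card = r := by
        rw [Finset.card_image_of_injOn (hφ.mono (by exact_mod_cast he₁)), he₂]
      refine ⟨(mem_shadowHG_edges hlt).mpr ⟨hcard, E, hE, hsub⟩, ?_⟩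
      obtain ⟨S, hS, hSe⟩ := Set.subset_image_iff.mp hsub
      obtain ⟨-, h⟩ := hall S
      obtain ⟨e', he', hce'⟩ := h ⟨hS, by
        rw [← Set.ncard_image_of_injective _ hn, hSe, Set.ncard_coe_finset, hcard]⟩
      have : e' = e.image φ := by exact_mod_cast he'.trans hSe
      simpa [this] using hce'
  choose f hf using hf
  obtain ⟨ψ, hψ, hψe⟩ := hsel f fun E hE => (hf E hE).1
  refine ⟨fun v => if h : v ∈ F.verts then n (ψ ⟨v, h⟩) else 0, ?_, ?_, ?_⟩
  · intro v hv w hw h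
    have hv' : v ∈ F.verts := hv
    have hw' : w ∈ F.verts := hw
    simp only [hv', hw', dif_pos] at h
    simpa using hψ (hn h)
  · intro v hv
    simp only [hv, dif_pos]
    exact Finset.mem_range.mpr (hlt _)
  · intro e he
    obtain ⟨E, hE, hfE⟩ := hψe e he
    obtain ⟨⟨hfsub, hfcard⟩, hfc⟩ := hf E hE
    have himage : ((e.image fun v => if h : v ∈ F.verts then n (ψ ⟨v, h⟩) else 0 :
        Finset ℕ) : Set ℕ) = n '' f E := by
      rw [hfE, Finset.coe_image]
      ext x
      constructor
      · rintro ⟨v, hv, rfl⟩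
        have hv' : v ∈ F.verts := F.edge_sub e he hv
        exact ⟨_, ⟨⟨v, hv'⟩, hv, rfl⟩, by simp [hv']⟩
      · rintro ⟨_, ⟨⟨v, hv'⟩, hv, rfl⟩, rfl⟩
        exact ⟨v, hv, by simp [hv']⟩
    refine ⟨(mem_shadowHG_edges hlt).mpr ⟨?_, E, hE, ?_⟩, hfc _ himage⟩
    · rw [← Set.ncard_coe_finset, himage, Set.ncard_image_of_injective _ hn, hfcard]
    · rw [himage]
      exact Set.image_mono hfsub

/-- If `K_s` does not arrow the cliques of orders `q i ≥ t` and `F` has no clique of order `t`,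
then some graph that does not arrow these cliques satisfies `G → (K_s, F)`. -/
theorem exists_not_arrowsList_and_arrows2 {r s t l : ℕ} (hr : 2 ≤ r) (hrt : r ≤ t) (hrs : r ≤ s)
    (q : Fin l → ℕ) (hq : ∀ i, t ≤ q i)
    (hs : ¬ ArrowsList (completeHG r s) l fun i => completeHG r (q i)) (F : HGraph r)
    (hfree : ∀ W ⊆ F.verts, W.card = t → ∃ e ⊆ W, e.card = r ∧ e ∉ F.edges) :
    ∃ G : HGraph r, ¬ ArrowsList G l (fun i => completeHG r (q i)) ∧
      Arrows2 G (completeHG r s) F := by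
  set 𝓕 : Set (Set F.verts) := {e | ∃ e' ∈ F.edges, (e' : Set ℕ) = Subtype.val '' e}
  have hcard : ∀ e ∈ 𝓕, e.ncard = r := by
    rintro e ⟨e', he', h⟩
    rw [← Set.ncard_image_of_injective e Subtype.val_injective, ← h, Set.ncard_coe_finset,
      F.edge_card e' he']
  have hfree' : ∀ W : Set F.verts, t ≤ W.ncard → ∃ S ⊆ W, S.ncard = r ∧ S ∉ 𝓕 := by
    intro W hW
    obtain ⟨W₁, hW₁, hW₁t⟩ := Set.exists_subset_card_eq hW
    obtain ⟨W₂, hW₂⟩ := (Set.toFinite (Subtype.val '' W₁)).exists_finset_coe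
    obtain ⟨e, heW, her, heF⟩ := hfree W₂ (by
      intro x hx
      have hx' : x ∈ Subtype.val '' W₁ := hW₂ ▸ hx
      obtain ⟨y, -, rfl⟩ := hx'
      exact y.2) (by
      rw [← Set.ncard_coe_finset, hW₂, Set.ncard_image_of_injective _ Subtype.val_injective,
        hW₁t])
    have he' : (e : Set ℕ) ⊆ Subtype.val '' W₁ := by
      rw [← hW₂]
      exact_mod_cast heW
    obtain ⟨S, hS, hSe⟩ := Set.subset_image_iff.mp he'
    refine ⟨S, hS.trans hW₁, ?_, ?_⟩
    · rw [← Set.ncard_image_of_injective S Subtype.val_injective, hSe, Set.ncard_coe_finset, her]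
    · rintro ⟨e', he'F, h⟩
      have : e' = e := by exact_mod_cast h.trans hSe
      exact heF (this ▸ he'F)
  obtain ⟨Y, _, V, ρ, K, hK, hsel⟩ :=
    exists_conformal_linear_selection (s := s) hr hrt hrs hcard hfree'
  set n : Y → ℕ := fun y => (Finite.equivFin Y y : ℕ)
  have hn : Function.Injective n := Fin.val_injective.comp (Finite.equivFin Y).injective
  have hlt : ∀ y, n y < Nat.card Y := fun y => (Finite.equivFin Y y).2
  refine ⟨shadowHG r n K, shadowHG_not_arrowsList hK hn hlt q hq hs,
    shadowHG_arrows2 hK hn hlt fun f hf => ?_⟩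
  obtain ⟨ψ, hψ, hψe⟩ := hsel f hf
  refine ⟨ψ, hψ, fun e he => hψe _ ⟨e, he, ?_⟩⟩
  exact (Set.image_preimage_eq_of_subset fun x hx => ⟨⟨x, F.edge_sub e he hx⟩, rfl⟩).symm

/-- Theorem: asymmetric Ramsey properties for hypergraph cliques.
For `r, ℓ ≥ 2`, `t_1 ≥ … ≥ t_ℓ > r`, and an `r`-graph `F` with `m_r(F) < m_r(K_{t_ℓ}^{(r)})`,
there is an `r`-graph `G` with `G ↛ (K_{t_1}^{(r)}, …, K_{t_ℓ}^{(r)})` and `G → (K_s^{(r)}, F)`,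
where `s = R(K_{t_1}^{(r)}, …, K_{t_ℓ}^{(r)}) − 1`. -/
theorem asymmetric_ramsey (r l : ℕ) (hr : 2 ≤ r) (hl : 2 ≤ l) (t : Fin l → ℕ)
    (hdec : ∀ i j : Fin l, i ≤ j → t j ≤ t i)
    (hlr : r < t ⟨l - 1, by omega⟩)
    (F : HGraph r)
    (hF : mDensity r F < mDensity r (completeHG r (t ⟨l - 1, by omega⟩))) :
    ∃ G : HGraph r,
      ¬ ArrowsList G l (fun i => completeHG r (t i)) ∧
        Arrows2 G (completeHG r (ramseyList r l (fun i => completeHG r (t i)) - 1)) F := by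
  set T := t ⟨l - 1, by omega⟩
  have hTle : ∀ i, T ≤ t i := fun i =>
    hdec i ⟨l - 1, by omega⟩ (Fin.mk_le_mk.mpr (by omega))
  have hfree : ∀ W ⊆ F.verts, W.card = T → ∃ e ⊆ W, e.card = r ∧ e ∉ F.edges := by
    intro W hW hcard
    by_contra! h
    exact absurd hF (not_lt.mpr (mDensity_completeHG_le hr hlr hW hcard h))
  have hcopy : ∀ (i : Fin l) (G : HGraph r) (Q : Finset ℕ → Prop),
      HasCopyWith (completeHG r (t i)) G Q → T ≤ G.verts.card := by
    rintro i G Q ⟨φ, hφ, hφv, -⟩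
    have := Finset.card_le_card_of_injOn φ hφv hφ
    rw [completeHG, Finset.card_range] at this
    exact (hTle i).trans this
  have hl₀ : 0 < l := by omega
  by_cases hne : {n | ∃ G : HGraph r, G.verts.card = n ∧
      ArrowsList G l (fun i => completeHG r (t i))}.Nonempty
  · obtain ⟨G, hG, hGarrow⟩ := Nat.sInf_mem hne
    obtain ⟨i, hi⟩ := hGarrow fun _ => ⟨0, hl₀⟩
    have hTR : T ≤ ramseyList r l (fun i => completeHG r (t i)) :=
      (hcopy i G _ hi).trans hG.le
    refine exists_not_arrowsList_and_arrows2 hr hlr.le (by omega) t hTle (fun harrow => ?_) F hfree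
    refine Nat.notMem_of_lt_sInf (m := ramseyList r l (fun i => completeHG r (t i)) - 1)
      (show _ < ramseyList r l (fun i => completeHG r (t i)) by omega)
      ⟨_, ?_, harrow⟩
    simp [completeHG]
  · refine ⟨⟨∅, ∅, by simp, by simp⟩, fun h => ?_, fun c => Or.inl ?_⟩
    · obtain ⟨i, hi⟩ := h fun _ => ⟨0, hl₀⟩
      have := hcopy i _ _ hi
      simp at this
      omega
    · have h₀ : ramseyList r l (fun i => completeHG r (t i)) = 0 := by
        rw [ramseyList, Set.not_nonempty_iff_eq_empty.mp hne, Nat.sInf_empty]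
      rw [h₀]
      refine ⟨id, Function.injective_id.injOn, by simp [completeHG], fun e he => ?_⟩
      obtain ⟨he₁, he₂⟩ := Finset.mem_powersetCard.mp he
      have he₀ : e = ∅ := by simpa using he₁
      rw [he₀, Finset.card_empty] at he₂
      omega
end

section
/- Let r,ℓ≥2 be integers and let t_1≥…≥t_ℓ>t≥r and s < R(K^{(r)}_{t_1},…,K^{(r)}_{t_ℓ}) be integers. Then there exists an r-graph G such that G ↛ (K^{(r)}_{t_1},…,K^{(r)}_{t_ℓ}) but G → (K^{(r)}_s, K^{(r)}_t). -/
open Finset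

open Combinatorics

/-- **Ramsey's theorem** for `r`-sets and two colors. -/
theorem exists_ramsey_number (r : ℕ) : ∀ s t : ℕ, ∃ N : ℕ,
    ∀ (α : Type) [DecidableEq α] (S : Finset α), N ≤ S.card → ∀ c : Finset α → Prop,
      (∃ A ⊆ S, A.card = s ∧ ∀ e ⊆ A, e.card = r → c e) ∨
        ∃ A ⊆ S, A.card = t ∧ ∀ e ⊆ A, e.card = r → ¬ c e := by
  induction r with
  | zero =>
    intro s t
    refine ⟨max s t, fun α _ S hS c => ?_⟩
    by_cases h : c ∅
    · obtain ⟨A, hA, hc⟩ := Finset.exists_subset_card_eq ((le_max_left s t).trans hS)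
      exact .inl ⟨A, hA, hc, fun e _ he => by rwa [Finset.card_eq_zero.mp he]⟩
    · obtain ⟨A, hA, hc⟩ := Finset.exists_subset_card_eq ((le_max_right s t).trans hS)
      exact .inr ⟨A, hA, hc, fun e _ he => by rwa [Finset.card_eq_zero.mp he]⟩
  | succ r ihr =>
    intro s
    induction s with
    | zero =>
      refine fun t => ⟨0, fun α _ S _ c => .inl ⟨∅, by simp, rfl, fun e he hc => ?_⟩⟩
      simp [Finset.subset_empty.mp he] at hc
    | succ s ihs =>
      intro t
      induction t with
      | zero =>
        refine ⟨0, fun α _ S _ c => .inr ⟨∅, by simp, rfl, fun e he hc => ?_⟩⟩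
        simp [Finset.subset_empty.mp he] at hc
      | succ t iht =>
        obtain ⟨N₁, h₁⟩ := ihs (t + 1)
        obtain ⟨N₂, h₂⟩ := iht
        obtain ⟨N, hN⟩ := ihr N₁ N₂
        refine ⟨N + 1, fun α _ S hS c => ?_⟩
        obtain ⟨x, hx⟩ : S.Nonempty := Finset.card_pos.mp (by omega)
        have hS' : N ≤ (S.erase x).card := by rw [Finset.card_erase_of_mem hx]; omega
        have extend : ∀ (A : Finset α) (p : Finset α → Prop), x ∉ A →
            (∀ e ⊆ A, e.card = r → p (insert x e)) → (∀ e ⊆ A, e.card = r + 1 → p e) →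
            ∀ e ⊆ insert x A, e.card = r + 1 → p e := by
          intro A p hxA h h' e he hc
          by_cases hxe : x ∈ e
          · rw [← Finset.insert_erase hxe]
            refine h _ (fun y hy => (Finset.mem_insert.mp (he (Finset.mem_of_mem_erase hy))).resolve_left
              (Finset.ne_of_mem_erase hy)) ?_
            rw [Finset.card_erase_of_mem hxe, hc, Nat.add_sub_cancel]
          · exact h' e ((Finset.subset_insert_iff_of_notMem hxe).mp he) hc
        have enlarge : ∀ (A B : Finset α), A ⊆ S.erase x → B ⊆ A → x ∉ B ∧ insert x B ⊆ S := by
          intro A B hA hB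
          refine ⟨fun h => Finset.notMem_erase x S (hA (hB h)), ?_⟩
          exact Finset.insert_subset hx ((hB.trans hA).trans (Finset.erase_subset _ _))
        rcases hN α _ hS' fun e => c (insert x e) with ⟨A, hA, hAc, hcol⟩ | ⟨A, hA, hAc, hcol⟩
        · rcases h₁ α A hAc.ge c with ⟨B, hB, hBc, hBcol⟩ | ⟨B, hB, hBc, hBcol⟩
          · obtain ⟨hxB, hBS⟩ := enlarge A B hA hB
            refine .inl ⟨insert x B, hBS, by rw [Finset.card_insert_of_notMem hxB, hBc], ?_⟩
            exact extend B c hxB (fun e he => hcol e (he.trans hB)) hBcol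
          · exact .inr ⟨B, hB.trans (hA.trans (Finset.erase_subset _ _)), hBc, hBcol⟩
        · rcases h₂ α A hAc.ge c with ⟨B, hB, hBc, hBcol⟩ | ⟨B, hB, hBc, hBcol⟩
          · exact .inl ⟨B, hB.trans (hA.trans (Finset.erase_subset _ _)), hBc, hBcol⟩
          · obtain ⟨hxB, hBS⟩ := enlarge A B hA hB
            refine .inr ⟨insert x B, hBS, by rw [Finset.card_insert_of_notMem hxB, hBc], ?_⟩
            exact extend B (fun e => ¬ c e) hxB (fun e he => hcol e (he.trans hB)) hBcol

/-- An `N`-partite system of `s`-element blocks on a finite vertex set in which every `r`-set lies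
in at most one block, and every set of more than `t` vertices all of whose `r`-subsets are covered
by blocks lies in a single block. -/
structure PartiteSystem (N r s t : ℕ) where
  V : Type
  finite : Finite V
  proj : V → Fin N
  blocks : Set (Finset V)
  card_block : ∀ X ∈ blocks, X.card = s
  injOn : ∀ X ∈ blocks, Set.InjOn proj X
  linear : ∀ X ∈ blocks, ∀ Y ∈ blocks, ∀ R ⊆ X, R ⊆ Y → R.card = r → X = Y
  conformal : ∀ W : Finset V, t < W.card →
    (∀ R ⊆ W, R.card = r → ∃ X ∈ blocks, R ⊆ X) → ∃ X ∈ blocks, W ⊆ X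

namespace PartiteSystem

open scoped Classical in
/-- The vertex of `X` in the same part as `v`, or `v` itself if there is none. -/
noncomputable def pull {N : ℕ} {V : Type} (proj : V → Fin N) (X : Finset V) (v : V) : V :=
  if h : ∃ u ∈ X, proj u = proj v then h.choose else v

theorem proj_pull {N : ℕ} {V : Type} (proj : V → Fin N) (X : Finset V) (v : V) :
    proj (pull proj X v) = proj v := by
  unfold pull
  split_ifs with h
  · exact h.choose_spec.2
  · rfl

theorem pull_mem {N : ℕ} {V : Type} {proj : V → Fin N} {X : Finset V} {v : V}
    (h : proj v ∈ X.image proj) : pull proj X v ∈ X := by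
  have h' : ∃ u ∈ X, proj u = proj v := Finset.mem_image.mp h
  rw [pull, dif_pos h']
  exact h'.choose_spec.1

variable {N r s t : ℕ}

/-- The blocks of `P` over the set of parts `e`. -/
abbrev BlocksOver (P : PartiteSystem N r s t) (e : Finset (Fin N)) : Type :=
  {X : Finset P.V // X ∈ P.blocks ∧ X.image P.proj = e}

/-- The vertices of the amalgam of copies of `P`, one for each combinatorial line, glued along
the parts in `e`. -/
inductive AmalgamVertex (P : PartiteSystem N r s t) (e : Finset (Fin N)) (ι : Type) : Type
  | shared (i : Fin N) (f : ι → P.V)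
  | own (l : Line (P.BlocksOver e) ι) (v : P.V)

variable {P : PartiteSystem N r s t} {e : Finset (Fin N)} {ι : Type}

namespace AmalgamVertex

theorem finite [Finite ι] : Finite (AmalgamVertex P e ι) := by
  have := P.finite
  have : Finite (Line (P.BlocksOver e) ι) :=
    Finite.of_injective Line.idxFun fun _ _ h => Line.ext h
  refine Finite.of_surjective
    (Sum.elim (fun p => shared p.1 p.2) fun p => own p.1 p.2 :
      (Fin N × (ι → P.V)) ⊕ (Line (P.BlocksOver e) ι × P.V) → AmalgamVertex P e ι) ?_
  rintro (⟨i, f⟩ | ⟨l, v⟩)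
  · exact ⟨.inl (i, f), rfl⟩
  · exact ⟨.inr (l, v), rfl⟩

/-- The part of a vertex of the amalgam. -/
def part : AmalgamVertex P e ι → Fin N
  | shared i _ => i
  | own _ v => P.proj v

/-- The `m`-th coordinate of a vertex of the amalgam. -/
def coord (m : ι) : AmalgamVertex P e ι → P.V
  | shared _ f => f m
  | own _ v => v

/-- The embedding of `P` in the amalgam belonging to the line `l`. -/
noncomputable def copy (l : Line (P.BlocksOver e) ι) (v : P.V) : AmalgamVertex P e ι :=
  if P.proj v ∈ e then
    shared (P.proj v) fun m => (l.idxFun m).elim v fun X => pull P.proj X.1 v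
  else own l v

/-- The block of `P` containing the `m`-th coordinates of the shared vertices in the copy of `X`
belonging to `l`. -/
def coordBlock (l : Line (P.BlocksOver e) ι) (X : Finset P.V) (m : ι) : Finset P.V :=
  (l.idxFun m).elim X Subtype.val

theorem part_copy (l : Line (P.BlocksOver e) ι) (v : P.V) : part (copy l v) = P.proj v := by
  unfold copy
  split_ifs <;> rfl

theorem proj_coord_copy (l : Line (P.BlocksOver e) ι) (v : P.V) (m : ι) :
    P.proj (coord m (copy l v)) = P.proj v := by
  unfold copy
  split_ifs
  · cases h : l.idxFun m <;> simp [coord, h, proj_pull]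
  · rfl

theorem coord_copy_of_none {l : Line (P.BlocksOver e) ι} {m : ι} (h : l.idxFun m = none)
    (v : P.V) : coord m (copy l v) = v := by
  unfold copy
  split_ifs
  · simp [coord, h]
  · rfl

theorem coordBlock_of_none {l : Line (P.BlocksOver e) ι} {m : ι} (h : l.idxFun m = none)
    (X : Finset P.V) : coordBlock l X m = X := by
  simp [coordBlock, h]

theorem coordBlock_mem (l : Line (P.BlocksOver e) ι) {X : Finset P.V} (hX : X ∈ P.blocks)
    (m : ι) : coordBlock l X m ∈ P.blocks := by
  unfold coordBlock
  cases l.idxFun m with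
  | none => exact hX
  | some a => exact a.2.1

theorem coord_copy_mem (l : Line (P.BlocksOver e) ι) {X : Finset P.V} {v : P.V} (hv : v ∈ X)
    (he : P.proj v ∈ e) (m : ι) : coord m (copy l v) ∈ coordBlock l X m := by
  cases h : l.idxFun m with
  | none => rwa [coord_copy_of_none h, coordBlock_of_none h]
  | some a =>
    have : P.proj v ∈ a.1.image P.proj := by rwa [a.2.2]
    simpa [copy, coordBlock, coord, he, h] using pull_mem this

theorem copy_injective (l : Line (P.BlocksOver e) ι) : Function.Injective (copy l) := by
  obtain ⟨m, hm⟩ := l.proper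
  intro u v h
  rw [← coord_copy_of_none hm u, h, coord_copy_of_none hm]

theorem proj_mem_of_copy_eq {l l' : Line (P.BlocksOver e) ι} (hl : l ≠ l') {v v' : P.V}
    (h : copy l v = copy l' v') : P.proj v ∈ e := by
  by_contra hv
  have hp : P.proj v = P.proj v' := by rw [← part_copy l v, h, part_copy]
  rw [copy, copy, if_neg hv, if_neg (hp ▸ hv)] at h
  exact hl (own.inj h).1

/-- Vertices of two copies coincide if their parts agree and each pair of coordinates lies in a
common block. -/
theorem copy_eq_copy {l l' : Line (P.BlocksOver e) ι} {X X' : Finset P.V} (hX : X ∈ P.blocks)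
    (h : ∀ m, coordBlock l X m = coordBlock l' X' m) {v v' : P.V} (hv : v ∈ X) (hv' : v' ∈ X')
    (hp : P.proj v = P.proj v') (he : P.proj v ∈ e) : copy l v = copy l' v' := by
  have key : ∀ m, coord m (copy l v) = coord m (copy l' v') := fun m =>
    P.injOn _ (coordBlock_mem l hX m) (coord_copy_mem l hv he m)
      (h m ▸ coord_copy_mem l' hv' (hp ▸ he) m)
      (by rw [proj_coord_copy, proj_coord_copy, hp])
  rw [copy, copy, if_pos he, if_pos (hp ▸ he)] at key ⊢
  rw [hp]
  congr 1
  exact funext key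

theorem line_eq {l l' : Line (P.BlocksOver e) ι} {X X' : Finset P.V}
    (hX : X.image P.proj ≠ e) (h : ∀ m, coordBlock l X m = coordBlock l' X' m) : l = l' := by
  have hne : ∀ a : P.BlocksOver e, X ≠ a.1 := fun a ha => hX (ha ▸ a.2.2)
  have hXX' : X = X' := by
    obtain ⟨m, hm⟩ := l.proper
    have hm' := h m
    rw [coordBlock_of_none hm, coordBlock] at hm'
    cases h' : l'.idxFun m with
    | none => simpa [h'] using hm'
    | some a => exact absurd (by simpa [h'] using hm') (hne a)
  subst hXX'
  refine Line.ext (funext fun m => ?_)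
  have hm := h m
  unfold coordBlock at hm
  cases h₁ : l.idxFun m <;> cases h₂ : l'.idxFun m <;> simp only [h₁, h₂, Option.elim] at hm
  · rfl
  · exact absurd hm (hne _)
  · exact absurd hm.symm (hne _)
  · exact congrArg some (Subtype.ext hm)

open scoped Classical in
theorem image_copy_eq {l l' : Line (P.BlocksOver e) ι} {X X' : Finset P.V} (hX : X ∈ P.blocks)
    (hX' : X' ∈ P.blocks) (he : X.image P.proj = e) (he' : X'.image P.proj = e)
    (h : ∀ m, coordBlock l X m = coordBlock l' X' m) :
    X.image (copy l) = X'.image (copy l') := by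
  have sub : ∀ {l l' : Line (P.BlocksOver e) ι} {X X' : Finset P.V}, X ∈ P.blocks →
      X.image P.proj = e → X'.image P.proj = e → (∀ m, coordBlock l X m = coordBlock l' X' m) →
      X.image (copy l) ⊆ X'.image (copy l') := by
    intro l l' X X' hX he he' h x hx
    obtain ⟨v, hv, rfl⟩ := Finset.mem_image.mp hx
    have hve : P.proj v ∈ e := he ▸ Finset.mem_image_of_mem _ hv
    obtain ⟨v', hv', hp⟩ := Finset.mem_image.mp (he'.symm ▸ hve)
    exact Finset.mem_image.mpr ⟨v', hv', (copy_eq_copy hX h hv hv' hp.symm hve).symm⟩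
  exact (sub hX he he' h).antisymm (sub hX' he' he fun m => (h m).symm)

end AmalgamVertex

open AmalgamVertex

open scoped Classical in
/-- The blocks of the amalgam are the copies of the blocks of `P`. -/
def amalgamBlocks (P : PartiteSystem N r s t) (e : Finset (Fin N)) (ι : Type) :
    Set (Finset (AmalgamVertex P e ι)) :=
  {Y | ∃ (l : Line (P.BlocksOver e) ι) (X : Finset P.V), X ∈ P.blocks ∧ Y = X.image (copy l)}

theorem injOn_part {Y : Finset (AmalgamVertex P e ι)} (hY : Y ∈ amalgamBlocks P e ι) :
    Set.InjOn part (Y : Set (AmalgamVertex P e ι)) := by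
  classical
  obtain ⟨l, X, hX, rfl⟩ := hY
  intro x hx y hy h
  obtain ⟨u, hu, rfl⟩ := Finset.mem_image.mp (Finset.mem_coe.mp hx)
  obtain ⟨v, hv, rfl⟩ := Finset.mem_image.mp (Finset.mem_coe.mp hy)
  rw [part_copy, part_copy] at h
  rw [P.injOn X hX hu hv h]

theorem proj_coord {Y : Finset (AmalgamVertex P e ι)} (hY : Y ∈ amalgamBlocks P e ι)
    {x : AmalgamVertex P e ι} (hx : x ∈ Y) (m : ι) : P.proj (coord m x) = part x := by
  classical
  obtain ⟨l, X, hX, rfl⟩ := hY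
  obtain ⟨u, hu, rfl⟩ := Finset.mem_image.mp hx
  rw [proj_coord_copy, part_copy]

theorem coord_mem_coordBlock {l : Line (P.BlocksOver e) ι} {X : Finset P.V}
    {R : Finset (AmalgamVertex P e ι)} (hR : ∀ x ∈ R, ∃ v ∈ X, copy l v = x)
    (he : ∀ v, copy l v ∈ R → P.proj v ∈ e) {x : AmalgamVertex P e ι} (hx : x ∈ R) (m : ι) :
    coord m x ∈ coordBlock l X m := by
  obtain ⟨v, hv, rfl⟩ := hR x hx
  exact coord_copy_mem l hv (he v hx) m

theorem amalgam_linear {Y Y' : Finset (AmalgamVertex P e ι)} (hY : Y ∈ amalgamBlocks P e ι)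
    (hY' : Y' ∈ amalgamBlocks P e ι) {R : Finset (AmalgamVertex P e ι)} (hR : R ⊆ Y)
    (hR' : R ⊆ Y') (hc : R.card = r) : Y = Y' := by
  classical
  have hinj : ∀ m, Set.InjOn (coord m) (R : Set (AmalgamVertex P e ι)) := fun m x hx y hy h =>
    injOn_part hY (hR hx) (hR hy) (by
      rw [← proj_coord hY (hR hx) m, ← proj_coord hY (hR hy) m, h])
  have hcard : ∀ m, (R.image (coord m)).card = r := fun m => by
    rw [Finset.card_image_of_injOn (hinj m), hc]
  obtain ⟨l, X, hX, rfl⟩ := hY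
  obtain ⟨l', X', hX', rfl⟩ := hY'
  have hRX : ∀ x ∈ R, ∃ v ∈ X, copy l v = x := fun x hx => Finset.mem_image.mp (hR hx)
  have hRX' : ∀ x ∈ R, ∃ v ∈ X', copy l' v = x := fun x hx => Finset.mem_image.mp (hR' hx)
  by_cases hl : l = l'
  · subst hl
    obtain ⟨m, hm⟩ := l.proper
    have : X = X' := by
      refine P.linear X hX X' hX' (R.image (coord m)) ?_ ?_ (hcard m) <;>
        refine Finset.image_subset_iff.mpr fun x hx => ?_
      · obtain ⟨v, hv, rfl⟩ := hRX x hx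
        rwa [coord_copy_of_none hm]
      · obtain ⟨v, hv, rfl⟩ := hRX' x hx
        rwa [coord_copy_of_none hm]
    rw [this]
  · have h : ∀ m, coordBlock l X m = coordBlock l' X' m := by
      refine fun m => P.linear _ (coordBlock_mem l hX m) _ (coordBlock_mem l' hX' m)
        (R.image (coord m)) ?_ ?_ (hcard m) <;>
        refine Finset.image_subset_iff.mpr fun x hx => ?_
      · refine coord_mem_coordBlock hRX (fun v hv => ?_) hx m
        obtain ⟨v', -, h'⟩ := hRX' _ hv
        exact proj_mem_of_copy_eq hl h'.symm
      · refine coord_mem_coordBlock hRX' (fun v hv => ?_) hx m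
        obtain ⟨v', -, h'⟩ := hRX _ hv
        exact proj_mem_of_copy_eq (Ne.symm hl) h'.symm
    by_cases he : X.image P.proj = e
    · by_cases he' : X'.image P.proj = e
      · convert image_copy_eq hX hX' he he' h
      · exact absurd (line_eq he' fun m => (h m).symm).symm hl
    · exact absurd (line_eq he h) hl

theorem amalgam_conformal (hr : 2 ≤ r) (hrt : r ≤ t) {W : Finset (AmalgamVertex P e ι)}
    (hW : t < W.card)
    (hcov : ∀ R ⊆ W, R.card = r → ∃ Y ∈ amalgamBlocks P e ι, R ⊆ Y) :
    ∃ Y ∈ amalgamBlocks P e ι, W ⊆ Y := by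
  classical
  have hpair : ∀ x ∈ W, ∀ y ∈ W, ∃ Y ∈ amalgamBlocks P e ι, x ∈ Y ∧ y ∈ Y := by
    intro x hx y hy
    obtain ⟨R, hxy, hRW, hRc⟩ := Finset.exists_subsuperset_card_eq (s := {x, y}) (t := W) (n := r)
      (by simp [Finset.insert_subset_iff, hx, hy]) (Finset.card_le_two.trans hr) (by omega)
    obtain ⟨Y, hY, hRY⟩ := hcov R hRW hRc
    exact ⟨Y, hY, hRY (hxy (by simp)), hRY (hxy (by simp))⟩
  have hinj : ∀ m, Set.InjOn (coord m) (W : Set (AmalgamVertex P e ι)) := by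
    intro m x hx y hy h
    obtain ⟨Y, hY, hxY, hyY⟩ := hpair x hx y hy
    exact injOn_part hY hxY hyY (by rw [← proj_coord hY hxY m, ← proj_coord hY hyY m, h])
  have hcard : ∀ m, ∀ R ⊆ W, (R.image (coord m)).card = R.card := fun m R hR =>
    Finset.card_image_of_injOn ((hinj m).mono hR)
  have hproj : ∀ m, (∀ R ⊆ W, R.card = r → ∃ Z ∈ P.blocks, R.image (coord m) ⊆ Z) →
      ∃ Z ∈ P.blocks, W.image (coord m) ⊆ Z := by
    intro m h
    refine P.conformal _ (by rwa [hcard m W subset_rfl]) fun R₀ hR₀ hc => ?_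
    obtain ⟨R, hR, rfl⟩ := Finset.subset_image_iff.mp hR₀
    exact h R hR (by rwa [hcard m R hR] at hc)
  by_cases hown : ∃ (l : Line (P.BlocksOver e) ι) (v : P.V), own l v ∈ W
  · obtain ⟨l, w, hw⟩ := hown
    have hcopy : ∀ x ∈ W, ∃ v, copy l v = x := by
      intro x hx
      obtain ⟨Y, ⟨l', X, hX, rfl⟩, hwY, hxY⟩ := hpair _ hw x hx
      obtain ⟨u, hu, hu'⟩ := Finset.mem_image.mp hwY
      obtain ⟨v, hv, hv'⟩ := Finset.mem_image.mp hxY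
      have : l' = l := by
        unfold copy at hu'
        split_ifs at hu'
        exact (own.inj hu').1
      exact ⟨v, this ▸ hv'⟩
    obtain ⟨m, hm⟩ := l.proper
    obtain ⟨Z, hZ, hWZ⟩ := hproj m fun R hR hc => by
      obtain ⟨Y, ⟨l', X, hX, rfl⟩, hRY⟩ := hcov R hR hc
      have hRX : ∀ x ∈ R, ∃ v ∈ X, copy l' v = x := fun x hx => Finset.mem_image.mp (hRY hx)
      refine ⟨coordBlock l' X m, coordBlock_mem l' hX m,
        Finset.image_subset_iff.mpr fun x hx => ?_⟩
      by_cases hl : l' = l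
      · subst hl
        obtain ⟨v, hv, rfl⟩ := hRX x hx
        rwa [coord_copy_of_none hm, coordBlock_of_none hm]
      · refine coord_mem_coordBlock hRX (fun v hv => ?_) hx m
        obtain ⟨v', h'⟩ := hcopy _ (hR hv)
        exact proj_mem_of_copy_eq hl h'.symm
    refine ⟨_, ⟨l, Z, hZ, rfl⟩, fun x hx => ?_⟩
    obtain ⟨v, rfl⟩ := hcopy x hx
    have := hWZ (Finset.mem_image_of_mem _ hx)
    rw [coord_copy_of_none hm] at this
    exact Finset.mem_image_of_mem _ this
  · have hmem : ∀ (l : Line (P.BlocksOver e) ι) v, copy l v ∈ W → P.proj v ∈ e := by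
      intro l v hv
      by_contra he
      rw [copy, if_neg he] at hv
      exact hown ⟨l, v, hv⟩
    have hblock : ∀ (l : Line (P.BlocksOver e) ι) (X R), R ⊆ W → R ⊆ X.image (copy l) →
        ∀ m, R.image (coord m) ⊆ coordBlock l X m := fun l X R hR hRY m =>
      Finset.image_subset_iff.mpr fun x hx =>
        coord_mem_coordBlock (fun x hx => Finset.mem_image.mp (hRY hx))
          (fun v hv => hmem l v (hR hv)) hx m
    obtain ⟨R, hR, hc⟩ := Finset.exists_subset_card_eq (s := W) (n := r) (by omega)
    obtain ⟨Y, ⟨l, X, hX, rfl⟩, hRY⟩ := hcov R hR hc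
    have hWX : ∀ m, W.image (coord m) ⊆ coordBlock l X m := by
      intro m
      obtain ⟨Z, hZ, hWZ⟩ := hproj m fun R hR hc => by
        obtain ⟨Y, ⟨l, X, hX, rfl⟩, hRY⟩ := hcov R hR hc
        exact ⟨_, coordBlock_mem l hX m, hblock l X R hR (by convert hRY) m⟩
      have : Z = coordBlock l X m :=
        P.linear Z hZ _ (coordBlock_mem l hX m) (R.image (coord m))
          ((Finset.image_subset_image hR).trans hWZ) (hblock l X R hR (by convert hRY) m)
          (by rw [hcard m R hR, hc])
      exact this ▸ hWZ
    refine ⟨_, ⟨l, X, hX, rfl⟩, fun x hx => ?_⟩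
    obtain ⟨m, hm⟩ := l.proper
    obtain ⟨Y', ⟨l', X', hX', rfl⟩, hxY', -⟩ := hpair x hx x hx
    obtain ⟨v', hv', rfl⟩ := Finset.mem_image.mp hxY'
    have hxX := hWX m (Finset.mem_image_of_mem _ hx)
    rw [coordBlock_of_none hm] at hxX
    have hp := proj_coord_copy l' v' m
    have he := hmem l' v' hx
    refine Finset.mem_image.mpr ⟨_, hxX, ?_⟩
    have key : ∀ m', coord m' (copy l (coord m (copy l' v'))) = coord m' (copy l' v') := fun m' =>
      P.injOn _ (coordBlock_mem l hX m') (coord_copy_mem l hxX (hp ▸ he) m')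
        (hWX m' (Finset.mem_image_of_mem _ hx)) (by simp only [proj_coord_copy])
    generalize coord m (copy l' v') = v at key hp
    rw [copy, copy, if_pos he, if_pos (hp ▸ he)] at key ⊢
    rw [hp]
    congr 1
    exact funext key

open scoped Classical in
/-- The amalgam of copies of `P` along the blocks over `e`. -/
noncomputable def amalgam (hr : 2 ≤ r) (hrt : r ≤ t) (P : PartiteSystem N r s t)
    (e : Finset (Fin N)) (ι : Type) [Finite ι] : PartiteSystem N r s t where
  V := AmalgamVertex P e ι
  finite := AmalgamVertex.finite
  proj := part
  blocks := amalgamBlocks P e ι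
  card_block := by
    rintro _ ⟨l, X, hX, rfl⟩
    rw [Finset.card_image_of_injective _ (copy_injective l), P.card_block X hX]
  injOn := fun _ hY => injOn_part hY
  linear := fun _ hY _ hY' _ hR hR' hc => amalgam_linear hY hY' hR hR' hc
  conformal := fun _ hW hcov => amalgam_conformal hr hrt hW hcov

open scoped Classical in
/-- A map of partite systems. -/
structure IsHom (P Q : PartiteSystem N r s t) (φ : P.V → Q.V) : Prop where
  proj_apply : ∀ v, Q.proj (φ v) = P.proj v
  map_block : ∀ X ∈ P.blocks, X.image φ ∈ Q.blocks

open scoped Classical in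
theorem exists_mono_copy (hr : 2 ≤ r) (hrt : r ≤ t) (P : PartiteSystem N r s t)
    (e : Finset (Fin N)) (κ : Type) [Finite κ] :
    ∃ Q : PartiteSystem N r s t, ∀ c : Finset Q.V → κ, ∃ φ : P.V → Q.V, P.IsHom Q φ ∧
      ∀ X ∈ P.blocks, ∀ Y ∈ P.blocks, X.image P.proj = e → Y.image P.proj = e →
        c (X.image φ) = c (Y.image φ) := by
  have := P.finite
  obtain ⟨ι, _, hι⟩ := Line.exists_mono_in_high_dimension (P.BlocksOver e) κ
  refine ⟨amalgam hr hrt P e ι, fun c => ?_⟩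
  obtain ⟨l, k, hk⟩ := hι fun w =>
    if h : ∃ p : Line (P.BlocksOver e) ι × P.BlocksOver e, p.1 p.2 = w then
      c (h.choose.2.1.image (copy h.choose.1)) else c ∅
  have hcol : ∀ X : P.BlocksOver e, c (X.1.image (copy l)) = k := by
    intro X
    have h : ∃ p : Line (P.BlocksOver e) ι × P.BlocksOver e, p.1 p.2 = l X := ⟨(l, X), rfl⟩
    have hX := hk X
    simp only [dif_pos h] at hX
    rw [← hX]
    congr 1
    refine image_copy_eq X.2.1 h.choose.2.2.1 X.2.2 h.choose.2.2.2 fun m => ?_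
    have hcoe : ∀ (l : Line (P.BlocksOver e) ι) (X : P.BlocksOver e),
        coordBlock l X.1 m = (l X m).1 := by
      intro l X
      unfold coordBlock
      rw [Line.coe_apply]
      cases l.idxFun m <;> rfl
    rw [hcoe, hcoe, h.choose_spec]
  refine ⟨copy l, ⟨part_copy l, fun X hX => ⟨l, X, hX, rfl⟩⟩, ?_⟩
  intro X hX Y hY he he'
  exact (hcol ⟨X, hX, he⟩).trans (hcol ⟨Y, hY, he'⟩).symm

open scoped Classical in
theorem IsHom.image_image {P Q : PartiteSystem N r s t} {φ : P.V → Q.V} (hφ : P.IsHom Q φ)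
    (Z : Finset P.V) : (Z.image φ).image Q.proj = Z.image P.proj := by
  rw [Finset.image_image]
  exact Finset.image_congr fun v _ => hφ.proj_apply v

open scoped Classical in
theorem exists_mono_hom (hr : 2 ≤ r) (hrt : r ≤ t) (P : PartiteSystem N r s t) (κ : Type)
    [Finite κ] (S : Finset (Finset (Fin N))) :
    ∃ Q : PartiteSystem N r s t, ∀ c : Finset Q.V → κ, ∃ φ : P.V → Q.V, P.IsHom Q φ ∧
      ∀ e ∈ S, ∀ X ∈ P.blocks, ∀ Y ∈ P.blocks, X.image P.proj = e → Y.image P.proj = e →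
        c (X.image φ) = c (Y.image φ) := by
  induction S using Finset.induction_on with
  | empty => exact ⟨P, fun c => ⟨id, ⟨fun _ => rfl, by simp⟩, by simp⟩⟩
  | insert e S _ ih =>
    obtain ⟨Q, hQ⟩ := ih
    obtain ⟨Q', hQ'⟩ := exists_mono_copy hr hrt Q e κ
    refine ⟨Q', fun c => ?_⟩
    obtain ⟨φ', hφ', hc'⟩ := hQ' c
    obtain ⟨φ, hφ, hc⟩ := hQ fun X => c (X.image φ')
    refine ⟨φ' ∘ φ, ⟨fun v => ?_, fun X hX => ?_⟩, fun f hf X hX Y hY hXf hYf => ?_⟩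
    · rw [Function.comp_apply, hφ'.proj_apply, hφ.proj_apply]
    · rw [← Finset.image_image]
      exact hφ'.map_block _ (hφ.map_block X hX)
    · rw [← Finset.image_image, ← Finset.image_image]
      rcases Finset.mem_insert.mp hf with rfl | hf
      · exact hc' _ (hφ.map_block X hX) _ (hφ.map_block Y hY) ((hφ.image_image X).trans hXf)
          ((hφ.image_image Y).trans hYf)
      · exact hc f hf X hX Y hY hXf hYf

/-- The vertices of the base system. Its components are indexed by a set `T` of parts and a choice
`b` of a set of parts for every `r`-subset of `T`. The vertices with `tag = none` are common to
several blocks of the component, those with `tag = some f` are private to the block of `f`. -/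
structure BaseVertex (N : ℕ) where
  T : Finset (Fin N)
  b : Finset (Fin N) → Finset (Fin N)
  part : Fin N
  tag : Option (Finset (Fin N))

namespace BaseVertex

theorem finite : Finite (BaseVertex N) := by
  refine Finite.of_injective (fun x : BaseVertex N => (x.T, x.b, x.part, x.tag)) ?_
  rintro ⟨T, b, i, g⟩ ⟨T', b', i', g'⟩ h
  simpa using h

/-- The vertex in part `i` of the block of `f` in the component of `T` and `b`. -/
def ofPart (T : Finset (Fin N)) (b : Finset (Fin N) → Finset (Fin N)) (f : Finset (Fin N))
    (i : Fin N) : BaseVertex N :=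
  ⟨T, b, i, if i ∈ f then none else some f⟩

open scoped Classical in
/-- The block of `f` in the component of `T` and `b`. -/
noncomputable def block (T : Finset (Fin N)) (b : Finset (Fin N) → Finset (Fin N))
    (f : Finset (Fin N)) : Finset (BaseVertex N) :=
  (b f).image (ofPart T b f)

theorem mem_block {T : Finset (Fin N)} {b : Finset (Fin N) → Finset (Fin N)}
    {f : Finset (Fin N)} {x : BaseVertex N} :
    x ∈ block T b f ↔ x.T = T ∧ x.b = b ∧ x.part ∈ b f ∧
      x.tag = if x.part ∈ f then none else some f := by
  obtain ⟨T', b', i, g⟩ := x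
  simp only [block, ofPart, Finset.mem_image, BaseVertex.mk.injEq]
  constructor
  · rintro ⟨j, hj, rfl, rfl, rfl, rfl⟩
    exact ⟨rfl, rfl, hj, rfl⟩
  · rintro ⟨hT, hb, hi, hg⟩
    exact ⟨i, hi, hT.symm, hb.symm, rfl, hg.symm⟩

theorem injOn_block (T : Finset (Fin N)) (b : Finset (Fin N) → Finset (Fin N))
    (f : Finset (Fin N)) : Set.InjOn part (block T b f : Set (BaseVertex N)) := by
  classical
  intro x hx y hy h
  obtain ⟨i, -, rfl⟩ := Finset.mem_image.mp (Finset.mem_coe.mp hx)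
  obtain ⟨j, -, rfl⟩ := Finset.mem_image.mp (Finset.mem_coe.mp hy)
  exact congrArg _ h

theorem image_part_block (T : Finset (Fin N)) (b : Finset (Fin N) → Finset (Fin N))
    (f : Finset (Fin N)) : (block T b f).image part = b f := by
  classical
  rw [block, Finset.image_image]
  exact Finset.image_id

/-- The condition for the base system to have a block of `f` in the component of `T` and `b`. -/
structure IsIndex (r s t : ℕ) (T : Finset (Fin N)) (b : Finset (Fin N) → Finset (Fin N))
    (f : Finset (Fin N)) : Prop where
  card_T : T.card ≤ t
  subset_T : f ⊆ T
  card : f.card = r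
  subset : f ⊆ b f
  card_b : (b f).card = s

theorem linear (hr : 2 ≤ r) {T T' f f' : Finset (Fin N)}
    {b b' : Finset (Fin N) → Finset (Fin N)} (hf : f.card = r) (hf' : f'.card = r)
    {R : Finset (BaseVertex N)} (hR : R ⊆ block T b f) (hR' : R ⊆ block T' b' f')
    (hc : R.card = r) : block T b f = block T' b' f' := by
  classical
  obtain ⟨x, hx⟩ : R.Nonempty := Finset.card_pos.mp (by omega)
  obtain ⟨rfl, rfl, -, -⟩ := mem_block.mp (hR hx)
  obtain ⟨hT, hb, -, -⟩ := mem_block.mp (hR' hx)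
  suffices f = f' by rw [hT, hb, this]
  by_contra hne
  have hcard : (R.image part).card = r := by
    rw [Finset.card_image_of_injOn ((injOn_block _ _ _).mono hR), hc]
  have hmem : ∀ y ∈ R, y.part ∈ f ∧ y.part ∈ f' := by
    intro y hy
    have h := (mem_block.mp (hR hy)).2.2.2
    have h' := (mem_block.mp (hR' hy)).2.2.2
    rw [h] at h'
    split_ifs at h' with h₁ h₂
    · exact ⟨h₁, h₂⟩
    · exact absurd (Option.some.inj h') hne
  have h₁ : R.image part = f := Finset.eq_of_subset_of_card_le
    (Finset.image_subset_iff.mpr fun y hy => (hmem y hy).1) (by omega)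
  have h₂ : R.image part = f' := Finset.eq_of_subset_of_card_le
    (Finset.image_subset_iff.mpr fun y hy => (hmem y hy).2) (by omega)
  exact hne (h₁.symm.trans h₂)

theorem conformal (hr : 2 ≤ r) (hrt : r ≤ t) {W : Finset (BaseVertex N)} (hW : t < W.card)
    (hcov : ∀ R ⊆ W, R.card = r → ∃ T b f, IsIndex r s t T b f ∧ R ⊆ block T b f) :
    ∃ T b f, IsIndex r s t T b f ∧ W ⊆ block T b f := by
  classical
  have hpair : ∀ x ∈ W, ∀ y ∈ W, ∃ f, IsIndex r s t x.T x.b f ∧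
      x ∈ block x.T x.b f ∧ y ∈ block x.T x.b f := by
    intro x hx y hy
    obtain ⟨R, hxy, hRW, hRc⟩ := Finset.exists_subsuperset_card_eq (s := {x, y}) (t := W) (n := r)
      (by simp [Finset.insert_subset_iff, hx, hy]) (Finset.card_le_two.trans hr) (by omega)
    obtain ⟨T, b, f, hf, hRf⟩ := hcov R hRW hRc
    have hxf := hRf (hxy (by simp : x ∈ _))
    obtain ⟨rfl, rfl, -, -⟩ := mem_block.mp hxf
    exact ⟨f, hf, hxf, hRf (hxy (by simp))⟩
  obtain ⟨x, hx⟩ : W.Nonempty := Finset.card_pos.mp (by omega)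
  by_cases h : ∃ w ∈ W, ∃ f, w.tag = some f
  · obtain ⟨w, hw, f, hwf⟩ := h
    have htag : ∀ f', w ∈ block w.T w.b f' → f' = f := by
      intro f' hf'
      have := (mem_block.mp hf').2.2.2
      rw [hwf] at this
      split_ifs at this
      exact (Option.some.inj this).symm
    obtain ⟨f', hf', hwf', -⟩ := hpair w hw w hw
    obtain rfl := htag f' hwf'
    refine ⟨w.T, w.b, f', hf', fun y hy => ?_⟩
    obtain ⟨g, -, hwg, hyg⟩ := hpair w hw y hy
    rwa [htag g hwg] at hyg
  · exfalso
    have hmaps : ∀ y ∈ W, y.part ∈ x.T := by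
      intro y hy
      obtain ⟨f, hf, -, hyf⟩ := hpair x hx y hy
      have htag := (mem_block.mp hyf).2.2.2
      split_ifs at htag with hmem
      · exact hf.subset_T hmem
      · exact absurd ⟨y, hy, f, htag⟩ h
    have hinj : Set.InjOn part (W : Set (BaseVertex N)) := by
      intro y hy z hz hyz
      obtain ⟨f, -, hyf, hzf⟩ := hpair y hy z hz
      exact injOn_block _ _ _ hyf hzf hyz
    obtain ⟨f, hf, -⟩ := hpair x hx x hx
    have := Finset.card_le_card_of_injOn part hmaps hinj
    have := hf.card_T
    omega

end BaseVertex

open BaseVertex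

/-- The disjoint union of all configurations consisting of at most `t` vertices and of a block
through each of some of their `r`-subsets, the blocks being disjoint otherwise. -/
noncomputable def base (N s : ℕ) (hr : 2 ≤ r) (hrt : r ≤ t) : PartiteSystem N r s t where
  V := BaseVertex N
  finite := BaseVertex.finite
  proj := BaseVertex.part
  blocks := {X | ∃ T b f, IsIndex r s t T b f ∧ X = block T b f}
  card_block := by
    rintro _ ⟨T, b, f, hf, rfl⟩
    rw [← hf.card_b, ← image_part_block T b f, Finset.card_image_of_injOn (injOn_block T b f)]
  injOn := by
    rintro _ ⟨T, b, f, -, rfl⟩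
    exact injOn_block T b f
  linear := by
    rintro _ ⟨T, b, f, hf, rfl⟩ _ ⟨T', b', f', hf', rfl⟩ R hR hR' hc
    exact BaseVertex.linear hr hf.card hf'.card hR hR' hc
  conformal := by
    intro W hW hcov
    obtain ⟨T, b, f, hf, hWf⟩ := BaseVertex.conformal (s := s) hr hrt hW fun R hR hc => by
      obtain ⟨_, ⟨T, b, f, hf, rfl⟩, hRf⟩ := hcov R hR hc
      exact ⟨T, b, f, hf, hRf⟩
    exact ⟨_, ⟨T, b, f, hf, rfl⟩, hWf⟩

/-- There is a system such that for every set of blue `r`-sets, if every block contains a blue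
`r`-set, then there are `t` vertices all of whose `r`-subsets are blue and covered by blocks. -/
theorem exists_ramsey_system (hr : 2 ≤ r) (hrt : r ≤ t) (hrs : r ≤ s) :
    ∃ (N : ℕ) (Q : PartiteSystem N r s t), ∀ blue : Finset Q.V → Prop,
      (∃ X ∈ Q.blocks, ∀ R ⊆ X, R.card = r → ¬ blue R) ∨
        ∃ W : Finset Q.V, W.card = t ∧
          ∀ R ⊆ W, R.card = r → blue R ∧ ∃ X ∈ Q.blocks, R ⊆ X := by
  classical
  obtain ⟨N, hN⟩ := exists_ramsey_number r s t
  obtain ⟨Q, hQ⟩ := exists_mono_hom hr hrt (base N s hr hrt) (Finset (Fin N)) Finset.univ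
  refine ⟨N, Q, fun blue => or_iff_not_imp_left.mpr fun hblue => ?_⟩
  push Not at hblue
  choose! g hgX hgc hgb using hblue
  obtain ⟨φ, hφ, hc⟩ := hQ fun X => (g X).image Q.proj
  have himage : ∀ Z : Finset (BaseVertex N), (Z.image φ).image Q.proj = Z.image BaseVertex.part :=
    hφ.image_image
  have hsub : ∀ X ∈ (base N s hr hrt).blocks,
      (g (X.image φ)).image Q.proj ⊆ X.image BaseVertex.part ∧
        ((g (X.image φ)).image Q.proj).card = r := by
    intro X hX
    have hXQ := hφ.map_block X hX
    refine ⟨(Finset.image_subset_image (hgX _ hXQ)).trans_eq (himage X), ?_⟩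
    rw [Finset.card_image_of_injOn ((Q.injOn _ hXQ).mono (hgX _ hXQ)), hgc _ hXQ]
  rcases hN (Fin N) Finset.univ (by simp) (fun f => ¬ ∃ X ∈ (base N s hr hrt).blocks,
    (g (X.image φ)).image Q.proj = f) with ⟨A, -, hA, hAcol⟩ | ⟨T, -, hT, hTcol⟩
  · exfalso
    obtain ⟨f, hfA, hf⟩ := Finset.exists_subset_card_eq (hrs.trans hA.ge)
    have hX : block f (fun _ => A) f ∈ (base N s hr hrt).blocks :=
      ⟨f, _, f, ⟨hf.trans_le hrt, subset_rfl, hf, hfA, hA⟩, rfl⟩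
    obtain ⟨h₁, h₂⟩ := hsub _ hX
    rw [image_part_block] at h₁
    exact hAcol _ h₁ h₂ ⟨_, hX, rfl⟩
  · simp only [not_not] at hTcol
    choose! X hX hXf using hTcol
    let b : Finset (Fin N) → Finset (Fin N) := fun f => (X f).image BaseVertex.part
    have hindex : ∀ f ⊆ T, f.card = r → IsIndex r s t T b f := by
      intro f hf hfc
      refine ⟨hT.le, hf, hfc, ?_, ?_⟩
      · have := (hsub _ (hX f hf hfc)).1
        rwa [hXf f hf hfc] at this
      · exact (Finset.card_image_of_injOn ((base N s hr hrt).injOn _ (hX f hf hfc))).trans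
          ((base N s hr hrt).card_block _ (hX f hf hfc))
    let ψ : Fin N → Q.V := fun i => φ (⟨T, b, i, none⟩ : BaseVertex N)
    have hψ : ∀ i, Q.proj (ψ i) = i := fun i => hφ.proj_apply _
    have hψinj : Function.Injective ψ := Function.LeftInverse.injective hψ
    refine ⟨T.image ψ, by rw [Finset.card_image_of_injective _ hψinj, hT], fun R hR hRc => ?_⟩
    obtain ⟨f, hf, rfl⟩ := Finset.subset_image_iff.mp hR
    have hfc : f.card = r := by rwa [Finset.card_image_of_injective _ hψinj] at hRc
    have hB : block T b f ∈ (base N s hr hrt).blocks := ⟨T, b, f, hindex f hf hfc, rfl⟩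
    have hBQ := hφ.map_block _ hB
    have hBf : (g ((block T b f).image φ)).image Q.proj = f := by
      exact (hc (b f) (Finset.mem_univ _) _ hB _ (hX f hf hfc) (image_part_block T b f) rfl).trans
        (hXf f hf hfc)
    have hgR : g ((block T b f).image φ) = f.image ψ := by
      refine Finset.eq_of_subset_of_card_le (fun x hx => ?_) (by rw [hRc, hgc _ hBQ])
      obtain ⟨v, hv, rfl⟩ := Finset.mem_image.mp (hgX _ hBQ hx)
      have hvf : BaseVertex.part v ∈ f := by
        have := Finset.mem_image_of_mem Q.proj hx
        rwa [hBf, hφ.proj_apply] at this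
      obtain ⟨i, -, rfl⟩ := Finset.mem_image.mp hv
      have hi : i ∈ f := hvf
      exact Finset.mem_image.mpr ⟨i, hi, by simp only [ψ, ofPart, if_pos hi]⟩
    exact ⟨hgR ▸ hgb _ hBQ, _, hBQ, hgR ▸ hgX _ hBQ⟩

end PartiteSystem

theorem hasCopyWith_completeHG {r k : ℕ} {G : HGraph r} {Q : Finset ℕ → Prop} {A : Finset ℕ}
    (hA : A.card = k) (hAG : A ⊆ G.verts)
    (h : ∀ R ⊆ A, R.card = r → R ∈ G.edges ∧ Q R) : HasCopyWith (completeHG r k) G Q := by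
  let φ : ℕ → ℕ := fun i => if hi : i < k then A.orderEmbOfFin hA ⟨i, hi⟩ else 0
  have hφ : ∀ i ∈ Finset.range k, φ i ∈ A := by
    intro i hi
    simp only [φ, dif_pos (Finset.mem_range.mp hi), Finset.orderEmbOfFin_mem]
  have hinj : Set.InjOn φ (Finset.range k : Set ℕ) := by
    intro i hi j hj hij
    simp only [Finset.coe_range, Set.mem_Iio] at hi hj
    simpa [φ, hi, hj] using hij
  refine ⟨φ, hinj, fun i hi => hAG (hφ i hi), fun e he => ?_⟩
  obtain ⟨hek, hec⟩ := Finset.mem_powersetCard.mp he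
  refine h _ (Finset.image_subset_iff.mpr fun i hi => hφ i (hek hi)) ?_
  rw [Finset.card_image_of_injOn (hinj.mono hek), hec]

namespace PartiteSystem

variable {N r s t : ℕ}

open scoped Classical in
/-- The `r`-graph of the `r`-sets covered by blocks of `Q`, with vertices numbered by `enc`. -/
noncomputable def toHGraph (Q : PartiteSystem N r s t) (V : Finset ℕ) (enc : Q.V ↪ ℕ) :
    HGraph r where
  verts := V
  edges := {R ∈ V.powersetCard r | ∃ X ∈ Q.blocks, R ⊆ X.map enc}
  edge_sub := fun _ he => (Finset.mem_powersetCard.mp (Finset.mem_filter.mp he).1).1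
  edge_card := fun _ he => (Finset.mem_powersetCard.mp (Finset.mem_filter.mp he).1).2

theorem not_arrowsList_toHGraph {Q : PartiteSystem N r s t} {V : Finset ℕ} {enc : Q.V ↪ ℕ}
    (hV : ∀ x ∈ V, ∃ v, enc v = x) {l : ℕ} {ts : Fin l → ℕ} (hts : ∀ i, t < ts i)
    (h : ¬ ArrowsList (completeHG r s) l fun i => completeHG r (ts i)) :
    ¬ ArrowsList (Q.toHGraph V enc) l fun i => completeHG r (ts i) := by
  classical
  unfold ArrowsList at h ⊢
  push Not at h ⊢
  obtain ⟨c₀, hc₀⟩ := h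
  have hσ : ∀ X ∈ Q.blocks, ∃ σ : ℕ → ℕ, Set.InjOn σ (X.map enc : Set ℕ) ∧
      ∀ x ∈ X.map enc, σ x ∈ Finset.range s := by
    intro X hX
    have hcard : (X.map enc).card = (Finset.range s).card := by
      rw [Finset.card_map, Q.card_block X hX, Finset.card_range]
    let q := Finset.equivOfCardEq hcard
    refine ⟨fun x => if hx : x ∈ X.map enc then q ⟨x, hx⟩ else 0, ?_, ?_⟩
    · intro x hx y hy hxy
      have hx' : x ∈ X.map enc := hx
      have hy' : y ∈ X.map enc := hy
      simp only [dif_pos hx', dif_pos hy'] at hxy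
      simpa using q.injective (Subtype.ext hxy)
    · intro x hx
      simp only [dif_pos hx]
      exact (q ⟨x, hx⟩).2
  choose! σ hσinj hσmem using hσ
  refine ⟨fun R => if hR : ∃ X ∈ Q.blocks, R ⊆ X.map enc then c₀ (R.image (σ hR.choose))
    else c₀ ∅, fun i => ?_⟩
  rintro ⟨ψ, hψinj, hψV, hψe⟩
  have hcard : ∀ e ⊆ Finset.range (ts i), (e.image ψ).card = e.card := fun e he =>
    Finset.card_image_of_injOn (hψinj.mono he)
  obtain ⟨W, hW⟩ : ∃ W : Finset Q.V, W.map enc = (Finset.range (ts i)).image ψ := by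
    refine ⟨((Finset.range (ts i)).image ψ).preimage enc enc.injective.injOn, ?_⟩
    rw [Finset.map_eq_image, Finset.image_preimage, Finset.filter_eq_self]
    intro x hx
    obtain ⟨j, hj, rfl⟩ := Finset.mem_image.mp hx
    exact hV _ (hψV j hj)
  have hWcard : W.card = ts i := by
    rw [← Finset.card_map enc, hW, hcard _ subset_rfl, Finset.card_range]
  obtain ⟨X, hX, hWX⟩ := Q.conformal W (hWcard ▸ hts i) fun R hR hc => by
    have hRW : R.map enc ⊆ (Finset.range (ts i)).image ψ := hW ▸ Finset.map_subset_map.mpr hR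
    obtain ⟨e, he, heR⟩ := Finset.subset_image_iff.mp hRW
    have hec : e.card = r := by rw [← hcard e he, heR, Finset.card_map, hc]
    have := (Finset.mem_filter.mp (hψe e (Finset.mem_powersetCard.mpr ⟨he, hec⟩)).1).2
    obtain ⟨X, hX, hRX⟩ := this
    exact ⟨X, hX, Finset.map_subset_map.mp (heR ▸ hRX)⟩
  have hψX : ∀ j ∈ Finset.range (ts i), ψ j ∈ X.map enc := fun j hj =>
    Finset.map_subset_map.mpr hWX (hW.symm ▸ Finset.mem_image_of_mem ψ hj)
  refine hc₀ i ⟨σ X ∘ ψ, (hσinj X hX).comp hψinj hψX, fun j hj => hσmem X hX _ (hψX j hj), ?_⟩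
  intro e he
  obtain ⟨her, hec⟩ := Finset.mem_powersetCard.mp he
  have heX : e.image ψ ⊆ X.map enc := Finset.image_subset_iff.mpr fun j hj => hψX j (her hj)
  have hex : ∃ X ∈ Q.blocks, e.image ψ ⊆ X.map enc := ⟨X, hX, heX⟩
  have hchoose : hex.choose = X := by
    obtain ⟨R, hR, hRe⟩ := Finset.subset_map_iff.mp heX
    refine Q.linear _ hex.choose_spec.1 X hX R ?_ hR ?_
    · exact Finset.map_subset_map.mp (hRe.symm.subset.trans hex.choose_spec.2)
    · rw [← Finset.card_map enc, ← hRe, hcard e her, hec]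
  have hcol := (hψe e he).2
  simp only [dif_pos hex, hchoose] at hcol
  rw [← Finset.image_image]
  refine ⟨Finset.mem_powersetCard.mpr ⟨?_, ?_⟩, hcol⟩
  · exact Finset.image_subset_iff.mpr fun x hx => hσmem X hX x (heX hx)
  · rw [Finset.card_image_of_injOn ((hσinj X hX).mono heX), hcard e her, hec]

theorem arrows2_toHGraph {Q : PartiteSystem N r s t} {V : Finset ℕ} {enc : Q.V ↪ ℕ}
    (hV : ∀ v, enc v ∈ V)
    (hQ : ∀ blue : Finset Q.V → Prop, (∃ X ∈ Q.blocks, ∀ R ⊆ X, R.card = r → ¬ blue R) ∨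
      ∃ W : Finset Q.V, W.card = t ∧ ∀ R ⊆ W, R.card = r → blue R ∧ ∃ X ∈ Q.blocks, R ⊆ X) :
    Arrows2 (Q.toHGraph V enc) (completeHG r s) (completeHG r t) := by
  classical
  intro c
  have hmap : ∀ X : Finset Q.V, X.map enc ⊆ V := by
    intro X x hx
    obtain ⟨v, -, rfl⟩ := Finset.mem_map.mp hx
    exact hV v
  have hedge : ∀ R : Finset Q.V, R.card = r → (∃ X ∈ Q.blocks, R ⊆ X) →
      R.map enc ∈ (Q.toHGraph V enc).edges := by
    rintro R hc ⟨X, hX, hRX⟩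
    exact Finset.mem_filter.mpr ⟨Finset.mem_powersetCard.mpr ⟨hmap R, by rw [Finset.card_map, hc]⟩,
      X, hX, Finset.map_subset_map.mpr hRX⟩
  rcases hQ fun R => c (R.map enc) = false with ⟨X, hX, hred⟩ | ⟨W, hW, hblue⟩
  · refine .inl (hasCopyWith_completeHG (A := X.map enc) ?_ (hmap X) fun R hR hc => ?_)
    · rw [Finset.card_map, Q.card_block X hX]
    · obtain ⟨R, hRX, rfl⟩ := Finset.subset_map_iff.mp hR
      rw [Finset.card_map] at hc
      exact ⟨hedge R hc ⟨X, hX, hRX⟩, by simpa using hred R hRX hc⟩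
  · refine .inr (hasCopyWith_completeHG (A := W.map enc) ?_ (hmap W) fun R hR hc => ?_)
    · rw [Finset.card_map, hW]
    · obtain ⟨R, hRW, rfl⟩ := Finset.subset_map_iff.mp hR
      rw [Finset.card_map] at hc
      exact ⟨hedge R hc (hblue R hRW hc).2, (hblue R hRW hc).1⟩

end PartiteSystem

theorem not_arrowsList_completeHG {r l s : ℕ} {F : Fin l → HGraph r} (hs : s < ramseyList r l F) :
    ¬ ArrowsList (completeHG r s) l F := fun h =>
  hs.not_ge (Nat.sInf_le ⟨completeHG r s, Finset.card_range s, h⟩)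

/-- Corollary. For `r, ℓ ≥ 2`, `t_1 ≥ … ≥ t_ℓ > t ≥ r` and
`s < R(K_{t_1}^{(r)}, …, K_{t_ℓ}^{(r)})`, there is an `r`-graph `G` with
`G ↛ (K_{t_1}^{(r)}, …, K_{t_ℓ}^{(r)})` but `G → (K_s^{(r)}, K_t^{(r)})`. -/
theorem asymmetric_ramsey_cor (r l t s : ℕ) (hr : 2 ≤ r) (hl : 2 ≤ l) (ts : Fin l → ℕ)
    (hdec : ∀ i j : Fin l, i ≤ j → ts j ≤ ts i)
    (hrt : r ≤ t) (htl : t < ts ⟨l - 1, by omega⟩)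
    (hs : s < ramseyList r l (fun i => completeHG r (ts i))) :
    ∃ G : HGraph r,
      ¬ ArrowsList G l (fun i => completeHG r (ts i)) ∧
        Arrows2 G (completeHG r s) (completeHG r t) := by
  classical
  have hnot := not_arrowsList_completeHG hs
  have hts : ∀ i, t < ts i := fun i => htl.trans_le (hdec _ _ (Fin.le_def.mpr (by simp; omega)))
  rcases lt_or_ge s r with hsr | hrs
  · refine ⟨completeHG r s, hnot, fun c => .inl ?_⟩
    refine hasCopyWith_completeHG (A := Finset.range s) (Finset.card_range s) subset_rfl ?_
    intro R hR hc
    have := Finset.card_le_card hR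
    rw [Finset.card_range] at this
    omega
  · obtain ⟨N, Q, hQ⟩ := PartiteSystem.exists_ramsey_system hr hrt hrs
    have := Q.finite
    have := Fintype.ofFinite Q.V
    let enc : Q.V ↪ ℕ := (Fintype.equivFin Q.V).toEmbedding.trans Fin.valEmbedding
    refine ⟨Q.toHGraph (Finset.univ.map enc) enc,
      PartiteSystem.not_arrowsList_toHGraph (fun x hx => ?_) hts hnot,
      PartiteSystem.arrows2_toHGraph (fun v => Finset.mem_map_of_mem _ (Finset.mem_univ v)) hQ⟩
    obtain ⟨v, -, hv⟩ := Finset.mem_map.mp hx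
    exact ⟨v, hv⟩
end

section
/- For any integer t ≥ 2, there exists a (simple) graph G such that G ↛ (K_t, K_t) and G → (K_s, K_{t−1}), where s = R(K_t, K_t) − 1. -/
open Finset

/-- Finite Ramsey theorem for graphs, in off-diagonal form. -/
theorem exists_clique_or_indep (m n : ℕ) : ∃ N : ℕ, ∀ {V : Type} (G : SimpleGraph V)
    (S : Finset V), N ≤ #S →
      (∃ T : Finset V, #T = m ∧ (T : Set V).Pairwise G.Adj) ∨
        ∃ T : Finset V, #T = n ∧ (T : Set V).Pairwise fun a b => ¬ G.Adj a b := by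
  classical
  suffices h : ∃ N : ℕ, ∀ {V : Type} (G : SimpleGraph V) (S : Finset V), N ≤ #S →
      (∃ T ⊆ S, #T = m ∧ (T : Set V).Pairwise G.Adj) ∨
        ∃ T ⊆ S, #T = n ∧ (T : Set V).Pairwise fun a b => ¬ G.Adj a b by
    obtain ⟨N, hN⟩ := h
    refine ⟨N, fun G S hS => ?_⟩
    rcases hN G S hS with ⟨T, -, h⟩ | ⟨T, -, h⟩
    exacts [.inl ⟨T, h⟩, .inr ⟨T, h⟩]
  induction m generalizing n with
  | zero => exact ⟨0, fun G S _ => .inl ⟨∅, by simp⟩⟩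
  | succ m ihm =>
    induction n with
    | zero => exact ⟨0, fun G S _ => .inr ⟨∅, by simp⟩⟩
    | succ n ihn =>
      obtain ⟨N₁, h₁⟩ := ihm (n + 1)
      obtain ⟨N₂, h₂⟩ := ihn
      refine ⟨N₁ + N₂ + 1, fun {V} G S hS => ?_⟩
      obtain ⟨v, hv⟩ : S.Nonempty := Finset.card_pos.mp (by omega)
      have hsplit := Finset.card_filter_add_card_filter_not (s := S.erase v) (G.Adj v)
      rw [Finset.card_erase_of_mem hv] at hsplit
      have key (p : V → V → Prop) (hp : ∀ a b, p a b → p b a) (q : V → Prop) [DecidablePred q]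
          (hq : ∀ w, q w → p v w) (k : ℕ) (T : Finset V) (hT : T ⊆ (S.erase v).filter q)
          (hk : #T = k) (hpw : (T : Set V).Pairwise p) :
          ∃ T ⊆ S, #T = k + 1 ∧ (T : Set V).Pairwise p := by
        refine ⟨insert v T, ?_, ?_, ?_⟩
        · exact Finset.insert_subset hv
            (hT.trans ((Finset.filter_subset _ _).trans (Finset.erase_subset _ _)))
        · rw [Finset.card_insert_of_notMem (fun h => by simpa using hT h), hk]
        · rw [Finset.coe_insert]
          refine hpw.insert fun b hb _ => ?_
          have := hq b (Finset.mem_filter.mp (hT hb)).2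
          exact ⟨this, hp _ _ this⟩
      have mono {T : Finset V} {q : V → Prop} [DecidablePred q]
          (hT : T ⊆ (S.erase v).filter q) : T ⊆ S :=
        hT.trans ((Finset.filter_subset _ _).trans (Finset.erase_subset _ _))
      rcases le_or_gt N₁ #((S.erase v).filter (G.Adj v)) with h | h
      · rcases h₁ G _ h with ⟨T, hT, hk, hpw⟩ | ⟨T, hT, hk⟩
        · exact .inl (key _ (fun _ _ h => h.symm) _ (fun _ h => h) m T hT hk hpw)
        · exact .inr ⟨T, mono hT, hk⟩
      · rcases h₂ G ((S.erase v).filter fun w => ¬ G.Adj v w) (by omega) with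
          ⟨T, hT, hk⟩ | ⟨T, hT, hk, hpw⟩
        · exact .inl ⟨T, mono hT, hk⟩
        · exact .inr (key (fun a b => ¬ G.Adj a b) (fun _ _ h h' => h h'.symm) _
            (fun _ h => h) n T hT hk hpw)

/-- Finite Ramsey theorem for graphs, phrased with embeddings of a finite type. -/
theorem exists_embedding_pairwise_adj_or_not (W : Type) [Finite W] :
    ∃ N : ℕ, ∀ G : SimpleGraph (Fin N), ∃ e : W ↪ Fin N,
      (Pairwise fun a b => G.Adj (e a) (e b)) ∨ Pairwise fun a b => ¬ G.Adj (e a) (e b) := by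
  have := Fintype.ofFinite W
  obtain ⟨N, hN⟩ := exists_clique_or_indep (Fintype.card W) (Fintype.card W)
  refine ⟨N, fun G => ?_⟩
  have key (p : Fin N → Fin N → Prop) (T : Finset (Fin N)) (hT : #T = Fintype.card W)
      (hp : (T : Set (Fin N)).Pairwise p) : ∃ e : W ↪ Fin N, Pairwise fun a b => p (e a) (e b) := by
    let g : W ≃ T := Fintype.equivOfCardEq (by simpa using hT.symm)
    refine ⟨g.toEmbedding.trans (Function.Embedding.subtype _), fun a b hab => ?_⟩
    exact hp (g a).2 (g b).2 fun h => hab (g.injective (Subtype.ext h))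
  rcases hN G Finset.univ (by simp) with ⟨T, hT, hp⟩ | ⟨T, hT, hp⟩
  · obtain ⟨e, he⟩ := key _ T hT hp
    exact ⟨e, .inl he⟩
  · obtain ⟨e, he⟩ := key _ T hT hp
    exact ⟨e, .inr he⟩

/-- A pair of edge-disjoint graphs on a finite vertex set, neither containing `K_t`, together with
a common proper vertex coloring by `I`. -/
structure PartiteSystem_s2 (t : ℕ) (I : Type) where
  V : Type
  finite : Finite V
  R : SimpleGraph V
  B : SimpleGraph V
  part : V → I
  part_ne_of_R : ∀ {u v}, R.Adj u v → part u ≠ part v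
  part_ne_of_B : ∀ {u v}, B.Adj u v → part u ≠ part v
  disjoint : ∀ {u v}, R.Adj u v → ¬ B.Adj u v
  noClique_R : ∀ k : Fin t → V, ¬ Pairwise fun a b => R.Adj (k a) (k b)
  noClique_B : ∀ k : Fin t → V, ¬ Pairwise fun a b => B.Adj (k a) (k b)

/-- The union of the images of a loopless relation under a family of maps respecting the parts. -/
def glue {V V' X I : Type} (S : SimpleGraph V) (part : V → I) (part' : V' → I)
    (hS : ∀ {u v}, S.Adj u v → part u ≠ part v) (f : X → V → V')
    (hf : ∀ x u, part' (f x u) = part u) : SimpleGraph V' where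
  Adj w w' := ∃ x u v, S.Adj u v ∧ f x u = w ∧ f x v = w'
  symm := ⟨fun _ _ ⟨x, u, v, h, hu, hv⟩ => ⟨x, v, u, h.symm, hv, hu⟩⟩
  loopless := ⟨fun _ ⟨x, u, v, h, hu, hv⟩ => hS h (by rw [← hf x u, ← hf x v, hu, hv])⟩

/-- If the glued copies are induced and overlap only in the parts `i` and `j`, gluing creates no
new cliques on at least three vertices. -/
theorem not_pairwise_glue_adj {V V' X I : Type} {S : SimpleGraph V} {part : V → I}
    {part' : V' → I} {hS : ∀ {u v}, S.Adj u v → part u ≠ part v} {f : X → V → V'}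
    {hf : ∀ x u, part' (f x u) = part u} {t : ℕ} (ht : 3 ≤ t) (i j : I)
    (overlap : ∀ {x x' u u'}, part u ≠ i → part u ≠ j → f x u = f x' u' → x = x')
    (induced : ∀ {x u v}, (glue S part part' hS f hf).Adj (f x u) (f x v) → S.Adj u v)
    (hclique : ∀ k : Fin t → V, ¬ Pairwise fun a b => S.Adj (k a) (k b)) (k : Fin t → V') :
    ¬ Pairwise fun a b => (glue S part part' hS f hf).Adj (k a) (k b) := by
  classical
  intro hk
  have hinj : Function.Injective (part' ∘ k) := by
    intro a b hab
    by_contra hne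
    obtain ⟨x, u, v, h, hu, hv⟩ := hk hne
    apply hS h
    rw [← hf x u, ← hf x v, hu, hv]
    exact hab
  obtain ⟨a, hai, haj⟩ : ∃ a, part' (k a) ≠ i ∧ part' (k a) ≠ j := by
    by_contra! h
    have hsub : Finset.univ.image (part' ∘ k) ⊆ {i, j} := by
      intro q hq
      obtain ⟨a, -, rfl⟩ := Finset.mem_image.mp hq
      have := h a
      simp only [Finset.mem_insert, Finset.mem_singleton, Function.comp]
      tauto
    have h₁ := Finset.card_le_card hsub
    rw [Finset.card_image_of_injective _ hinj, Finset.card_fin] at h₁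
    have := Finset.card_le_two (a := i) (b := j)
    omega
  have : Nontrivial (Fin t) := Fin.nontrivial_iff_two_le.mpr (by omega)
  obtain ⟨b, hb⟩ := exists_ne a
  obtain ⟨x, u, v, h, hu, hv⟩ := hk hb.symm
  rw [← hu, hf] at hai haj
  have hmem (c : Fin t) : ∃ w, f x w = k c := by
    by_cases hc : c = a
    · exact ⟨u, by rw [hu, hc]⟩
    · obtain ⟨x', u', v', h', hu', hv'⟩ := hk (Ne.symm hc)
      obtain rfl := overlap hai haj (hu.trans hu'.symm)
      exact ⟨v', hv'⟩
  choose g hg using hmem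
  refine hclique g fun c d hcd => induced (x := x) ?_
  rw [hg, hg]
  exact hk hcd

namespace PartiteSystem_s2

variable {t : ℕ} {I : Type}

/-- A part-preserving map between systems that is a homomorphism for both graphs. -/
structure IsHom_s2 (P Q : PartiteSystem_s2 t I) (f : P.V → Q.V) : Prop where
  part : ∀ u, Q.part (f u) = P.part u
  R : ∀ {u v}, P.R.Adj u v → Q.R.Adj (f u) (f v)
  B : ∀ {u v}, P.B.Adj u v → Q.B.Adj (f u) (f v)

/-- The `R`-edges of a system between two given parts. -/
abbrev CrossEdge (P : PartiteSystem_s2 t I) (i j : I) : Type :=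
  {e : P.V × P.V // P.part e.1 = i ∧ P.part e.2 = j ∧ P.R.Adj e.1 e.2}

open Classical in
/-- One coordinate of the embedding of a system along a combinatorial line of `R`-edges. -/
noncomputable def lineCoord (P : PartiteSystem_s2 t I) (i j : I) (o : Option (P.CrossEdge i j))
    (u : P.V) : P.V :=
  o.elim u fun e => if P.part u = i then e.1.1 else if P.part u = j then e.1.2 else u

open Classical in
/-- The embedding of a system along a combinatorial line `x` of `R`-edges between the parts `i`
and `j`. Vertices outside these parts are labelled by `x`. -/
noncomputable def lineMap (P : PartiteSystem_s2 t I) (i j : I) {ι : Type}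
    (x : ι → Option (P.CrossEdge i j)) (u : P.V) :
    (ι → P.V) × Option (ι → Option (P.CrossEdge i j)) :=
  (fun c => P.lineCoord i j (x c) u, if P.part u = i ∨ P.part u = j then none else some x)

variable {P : PartiteSystem_s2 t I} {i j : I}

theorem part_lineCoord (o : Option (P.CrossEdge i j)) (u : P.V) :
    P.part (P.lineCoord i j o u) = P.part u := by
  rcases o with _ | ⟨e, h₁, h₂, -⟩
  · rfl
  · simp only [lineCoord, Option.elim]
    split_ifs <;> simp_all

theorem R_lineCoord_some (e : P.CrossEdge i j) {u v : P.V} (hu : P.part u = i ∨ P.part u = j)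
    (hv : P.part v = i ∨ P.part v = j) (huv : P.part u ≠ P.part v) :
    P.R.Adj (P.lineCoord i j (some e) u) (P.lineCoord i j (some e) v) := by
  obtain ⟨e, h₁, h₂, h⟩ := e
  simp only [lineCoord, Option.elim]
  rcases hu with hu | hu <;> rcases hv with hv | hv
  · exact absurd (hu.trans hv.symm) huv
  · rw [if_pos hu, if_neg (fun h => huv (hu.trans h.symm)), if_pos hv]
    exact h
  · rw [if_pos hv, if_neg (fun h => huv (h.trans hv.symm)), if_pos hu]
    exact h.symm
  · exact absurd (hu.trans hv.symm) huv

theorem R_lineCoord (o : Option (P.CrossEdge i j)) {u v : P.V}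
    (hu : P.part u = i ∨ P.part u = j) (hv : P.part v = i ∨ P.part v = j) (h : P.R.Adj u v) :
    P.R.Adj (P.lineCoord i j o u) (P.lineCoord i j o v) := by
  rcases o with _ | e
  · exact h
  · exact R_lineCoord_some e hu hv (P.part_ne_of_R h)

section lineMap

variable {ι : Type} {x x' : ι → Option (P.CrossEdge i j)} {u v u' v' : P.V}

theorem lineCoord_eq_of_lineMap_eq (h : P.lineMap i j x u = P.lineMap i j x' u') (c : ι) :
    P.lineCoord i j (x c) u = P.lineCoord i j (x' c) u' :=
  congrFun (congrArg Prod.fst h) c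

theorem lineMap_label_eq (hi : P.part u ≠ i) (hj : P.part u ≠ j)
    (hpart : P.part u = P.part u')
    (h : P.lineMap i j x u = P.lineMap i j x' u') : x = x' := by
  have := congrArg Prod.snd h
  simpa [lineMap, hi, hj, ← hpart] using this

theorem part_eq_of_lineMap_eq (c : ι) (h : P.lineMap i j x u = P.lineMap i j x' u') :
    P.part u = P.part u' := by
  rw [← part_lineCoord (x c) u, lineCoord_eq_of_lineMap_eq h, part_lineCoord]

theorem lineMap_injective (hx : ∃ c, x c = none) : Function.Injective (P.lineMap i j x) := by
  obtain ⟨c, hc⟩ := hx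
  intro u v h
  simpa [hc, lineCoord] using lineCoord_eq_of_lineMap_eq h c

/-- Two vertices of a copy along a line are both in the special parts, or determine the line. -/
theorem parts_or_eq_of_lineMap_eq (hx : ∃ c, x c = none)
    (hu : P.lineMap i j x u = P.lineMap i j x' u')
    (hv : P.lineMap i j x v = P.lineMap i j x' v') :
    ((P.part u = i ∨ P.part u = j) ∧ (P.part v = i ∨ P.part v = j)) ∨ (u = u' ∧ v = v') := by
  obtain ⟨c, -⟩ := id hx
  have key : x = x' → u = u' ∧ v = v' := by
    rintro rfl
    exact ⟨lineMap_injective hx hu, lineMap_injective hx hv⟩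
  by_cases h₁ : P.part u = i ∨ P.part u = j
  · by_cases h₂ : P.part v = i ∨ P.part v = j
    · exact .inl ⟨h₁, h₂⟩
    · rw [not_or] at h₂
      exact .inr (key (lineMap_label_eq h₂.1 h₂.2 (part_eq_of_lineMap_eq c hv) hv))
  · rw [not_or] at h₁
    exact .inr (key (lineMap_label_eq h₁.1 h₁.2 (part_eq_of_lineMap_eq c hu) hu))

theorem R_of_lineMap_eq (hx : ∃ c, x c = none)
    (hu : P.lineMap i j x u = P.lineMap i j x' u')
    (hv : P.lineMap i j x v = P.lineMap i j x' v') (h : P.R.Adj u' v') : P.R.Adj u v := by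
  rcases parts_or_eq_of_lineMap_eq hx hu hv with ⟨h₁, h₂⟩ | ⟨rfl, rfl⟩
  · obtain ⟨c, hc⟩ := hx
    rw [part_eq_of_lineMap_eq c hu] at h₁
    rw [part_eq_of_lineMap_eq c hv] at h₂
    have := R_lineCoord (x' c) h₁ h₂ h
    rwa [← lineCoord_eq_of_lineMap_eq hu, ← lineCoord_eq_of_lineMap_eq hv, hc] at this
  · exact h

theorem B_of_lineMap_eq (hx : ∃ c, x c = none) (hx' : ∃ c, x' c = none)
    (hu : P.lineMap i j x u = P.lineMap i j x' u')
    (hv : P.lineMap i j x v = P.lineMap i j x' v') (h : P.B.Adj u' v') : P.B.Adj u v := by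
  rcases parts_or_eq_of_lineMap_eq hx hu hv with ⟨h₁, h₂⟩ | ⟨rfl, rfl⟩
  · obtain ⟨c, hc⟩ := hx
    have hcu := lineCoord_eq_of_lineMap_eq hu c
    have hcv := lineCoord_eq_of_lineMap_eq hv c
    rw [hc] at hcu hcv
    rcases hx'c : x' c with _ | e
    · rw [hx'c] at hcu hcv
      change u = u' at hcu
      change v = v' at hcv
      rwa [hcu, hcv]
    · have hR : P.R.Adj u v := by
        have := R_lineCoord_some e (part_eq_of_lineMap_eq c hu ▸ h₁)
          (part_eq_of_lineMap_eq c hv ▸ h₂) (P.part_ne_of_B h)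
        rwa [← hx'c, ← lineCoord_eq_of_lineMap_eq hu, ← lineCoord_eq_of_lineMap_eq hv, hc] at this
      exact absurd h (P.disjoint (R_of_lineMap_eq hx' hu.symm hv.symm hR))
  · exact h

end lineMap

/-- Partite amalgamation: one can pass to a larger system in which every coloring is constant on
the `R`-edges between two given parts of some copy of the original system. -/
theorem exists_mono_cross (ht : 3 ≤ t) (P : PartiteSystem_s2 t I) {i j : I} (hij : i ≠ j) :
    ∃ Q : PartiteSystem_s2 t I, ∀ χ : Q.V → Q.V → Bool, ∃ f : P.V → Q.V, P.IsHom_s2 Q f ∧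
      ∃ c, ∀ u v, P.part u = i → P.part v = j → P.R.Adj u v → χ (f u) (f v) = c := by
  have := P.finite
  obtain ⟨ι, _, hι⟩ :=
    Combinatorics.Line.exists_mono_in_high_dimension (P.CrossEdge i j) Bool
  obtain ⟨l₀, -⟩ := hι fun _ => true
  obtain ⟨c₀, -⟩ := l₀.proper
  let X := {x : ι → Option (P.CrossEdge i j) // ∃ c, x c = none}
  let f : X → P.V → (ι → P.V) × Option (ι → Option (P.CrossEdge i j)) :=
    fun x => P.lineMap i j x.1
  let part' : (ι → P.V) × Option (ι → Option (P.CrossEdge i j)) → I := fun w => P.part (w.1 c₀)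
  have hf (x : X) (u : P.V) : part' (f x u) = P.part u := part_lineCoord _ _
  have overlap {x x' : X} {u u' : P.V} (hi : P.part u ≠ i) (hj : P.part u ≠ j)
      (h : f x u = f x' u') : x = x' :=
    Subtype.ext (lineMap_label_eq hi hj (part_eq_of_lineMap_eq c₀ h) h)
  have indR {x : X} {u v : P.V}
      (h : (glue P.R P.part part' P.part_ne_of_R f hf).Adj (f x u) (f x v)) : P.R.Adj u v := by
    obtain ⟨x', u', v', h, hu, hv⟩ := h
    exact R_of_lineMap_eq x.2 hu.symm hv.symm h
  have indB {x : X} {u v : P.V}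
      (h : (glue P.B P.part part' P.part_ne_of_B f hf).Adj (f x u) (f x v)) : P.B.Adj u v := by
    obtain ⟨x', u', v', h, hu, hv⟩ := h
    exact B_of_lineMap_eq x.2 x'.2 hu.symm hv.symm h
  let Q : PartiteSystem_s2 t I :=
    { V := (ι → P.V) × Option (ι → Option (P.CrossEdge i j))
      finite := inferInstance
      R := glue P.R P.part part' P.part_ne_of_R f hf
      B := glue P.B P.part part' P.part_ne_of_B f hf
      part := part'
      part_ne_of_R := by
        rintro _ _ ⟨x, u, v, h, rfl, rfl⟩
        rw [hf, hf]
        exact P.part_ne_of_R h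
      part_ne_of_B := by
        rintro _ _ ⟨x, u, v, h, rfl, rfl⟩
        rw [hf, hf]
        exact P.part_ne_of_B h
      disjoint := by
        rintro _ _ ⟨x, u, v, h, rfl, rfl⟩ h'
        exact P.disjoint h (indB h')
      noClique_R := not_pairwise_glue_adj ht i j overlap indR P.noClique_R
      noClique_B := not_pairwise_glue_adj ht i j overlap indB P.noClique_B }
  refine ⟨Q, fun χ => ?_⟩
  obtain ⟨l, c, hc⟩ := hι fun g => χ (fun d => (g d).1.1, none) (fun d => (g d).1.2, none)
  let x : X := ⟨l.idxFun, l.proper⟩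
  refine ⟨f x, ⟨hf x, fun h => ⟨x, _, _, h, rfl, rfl⟩, fun h => ⟨x, _, _, h, rfl, rfl⟩⟩,
    c, fun u v hu hv h => ?_⟩
  have hc' := hc ⟨(u, v), hu, hv, h⟩
  convert hc' using 2
  · ext d
    · change P.lineCoord i j (l.idxFun d) u = ((l.idxFun d).getD _).1.1
      rcases l.idxFun d with _ | e <;> simp [lineCoord, hu]
    · simp [f, lineMap, hu]
  · ext d
    · change P.lineCoord i j (l.idxFun d) v = ((l.idxFun d).getD _).1.2
      rcases l.idxFun d with _ | e <;> simp [lineCoord, hij.symm, hv]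
    · simp [f, lineMap, hv]

theorem exists_mono_cross_list (ht : 3 ≤ t) (P : PartiteSystem_s2 t I) (L : List (I × I))
    (hL : ∀ e ∈ L, e.1 ≠ e.2) :
    ∃ Q : PartiteSystem_s2 t I, ∀ χ : Q.V → Q.V → Bool, ∃ f : P.V → Q.V, P.IsHom_s2 Q f ∧
      ∀ e ∈ L, ∃ c, ∀ u v, P.part u = e.1 → P.part v = e.2 → P.R.Adj u v →
        χ (f u) (f v) = c := by
  induction L generalizing P with
  | nil => exact ⟨P, fun χ => ⟨id, ⟨fun _ => rfl, id, id⟩, by simp⟩⟩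
  | cons e L ih =>
    obtain ⟨P₁, h₁⟩ := P.exists_mono_cross ht (hL e (by simp))
    obtain ⟨Q, hQ⟩ := ih P₁ fun e' he' => hL e' (by simp [he'])
    refine ⟨Q, fun χ => ?_⟩
    obtain ⟨g, hg, hgL⟩ := hQ χ
    obtain ⟨f, hf, c, hc⟩ := h₁ fun u v => χ (g u) (g v)
    refine ⟨g ∘ f, ⟨fun u => by simp [hg.part, hf.part], fun h => hg.R (hf.R h),
      fun h => hg.B (hf.B h)⟩, fun e' he' => ?_⟩
    rcases List.mem_cons.mp he' with rfl | he'
    · exact ⟨c, hc⟩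
    · obtain ⟨c', hc'⟩ := hgL e' he'
      exact ⟨c', fun u v hu hv h =>
        hc' _ _ ((hf.part u).trans hu) ((hf.part v).trans hv) (hf.R h)⟩

end PartiteSystem_s2

/-- A special case of the Nešetřil–Rödl theorem: for pairs of edge-disjoint `K_t`-free graphs, one
can color the edges of the first graph of a larger such pair and always find a copy of the original
pair whose first graph is monochromatic. -/
theorem exists_pair_arrow {t : ℕ} (ht : 3 ≤ t) {W : Type} [Finite W] (R B : SimpleGraph W)
    (hd : ∀ {u v}, R.Adj u v → ¬ B.Adj u v)
    (hR : ∀ k : Fin t → W, ¬ Pairwise fun a b => R.Adj (k a) (k b))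
    (hB : ∀ k : Fin t → W, ¬ Pairwise fun a b => B.Adj (k a) (k b)) :
    ∃ (V : Type) (_ : Finite V) (R' B' : SimpleGraph V),
      (∀ {u v}, R'.Adj u v → ¬ B'.Adj u v) ∧
      (∀ k : Fin t → V, ¬ Pairwise fun a b => R'.Adj (k a) (k b)) ∧
      (∀ k : Fin t → V, ¬ Pairwise fun a b => B'.Adj (k a) (k b)) ∧
      ∀ χ : V → V → Bool, (∀ u v, χ u v = χ v u) →
        ∃ (f : R →g R') (g : B →g B'), (∀ a, f a = g a) ∧
          ∃ c, ∀ a b, R.Adj a b → χ (f a) (f b) = c := by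
  obtain ⟨N, hN⟩ := exists_embedding_pairwise_adj_or_not W
  let copies (S : SimpleGraph W) : SimpleGraph ((W ↪ Fin N) × W) :=
    { Adj := fun x y => x.1 = y.1 ∧ S.Adj x.2 y.2
      symm := ⟨fun _ _ h => ⟨h.1.symm, h.2.symm⟩⟩
      loopless := ⟨fun _ h => h.2.ne rfl⟩ }
  have hpart (S : SimpleGraph W) {x y : (W ↪ Fin N) × W} (h : (copies S).Adj x y) :
      x.1 x.2 ≠ y.1 y.2 := by
    rw [h.1]
    exact fun h' => h.2.ne (y.1.injective h')
  let P : PartiteSystem_s2 t (Fin N) :=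
    { V := (W ↪ Fin N) × W
      finite := inferInstance
      R := copies R
      B := copies B
      part := fun x => x.1 x.2
      part_ne_of_R := hpart R
      part_ne_of_B := hpart B
      disjoint := fun h h' => hd h.2 h'.2
      noClique_R := fun k hk => hR (fun a => (k a).2) fun _ _ hab => (hk hab).2
      noClique_B := fun k hk => hB (fun a => (k a).2) fun _ _ hab => (hk hab).2 }
  obtain ⟨Q, hQ⟩ := P.exists_mono_cross_list ht
    (((Finset.univ : Finset (Fin N × Fin N)).filter fun e => e.1 ≠ e.2).toList) (by simp)
  refine ⟨Q.V, Q.finite, Q.R, Q.B, Q.disjoint, Q.noClique_R, Q.noClique_B, fun χ hχ => ?_⟩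
  obtain ⟨f, hf, hmono⟩ := hQ χ
  have hmono' (e : Fin N × Fin N) : ∃ c, e.1 ≠ e.2 → ∀ u v, P.part u = e.1 → P.part v = e.2 →
      P.R.Adj u v → χ (f u) (f v) = c := by
    by_cases he : e.1 ≠ e.2
    · obtain ⟨c, hc⟩ := hmono e (by simpa using he)
      exact ⟨c, fun _ => hc⟩
    · exact ⟨true, fun h => absurd h he⟩
  choose c hc using hmono'
  obtain ⟨e, he⟩ := hN (SimpleGraph.fromRel fun i j => c (i, j) = true)
  have hcol {a b : W} (h : R.Adj a b) : χ (f (e, a)) (f (e, b)) = c (e a, e b) :=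
    hc (e a, e b) (e.injective.ne h.ne) (e, a) (e, b) rfl rfl ⟨rfl, h⟩
  refine ⟨⟨fun a => f (e, a), fun h => hf.R ⟨rfl, h⟩⟩, ⟨fun a => f (e, a), fun h => hf.B ⟨rfl, h⟩⟩,
    fun _ => rfl, ?_⟩
  rcases he with he | he
  · refine ⟨true, fun a b h => ?_⟩
    rcases ((SimpleGraph.fromRel_adj _ _ _).mp (he h.ne)).2 with h' | h'
    · exact (hcol h).trans h'
    · exact (hχ _ _).trans ((hcol h.symm).trans h')
  · refine ⟨false, fun a b h => ?_⟩
    have := he h.ne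
    simp only [SimpleGraph.fromRel_adj, ne_eq, EmbeddingLike.apply_eq_iff_eq, h.ne,
      not_false_eq_true, true_and, not_or, Bool.not_eq_true] at this
    exact (hcol h).trans this.1

/-- Copies of a complete graph, described by their vertices. -/
theorem hasCopyWith_completeHG_iff {m : ℕ} {G : HGraph 2} {Q : Finset ℕ → Prop} :
    HasCopyWith (completeHG 2 m) G Q ↔ ∃ k : Fin m → ℕ, Function.Injective k ∧
      (∀ a, k a ∈ G.verts) ∧ Pairwise fun a b => {k a, k b} ∈ G.edges ∧ Q {k a, k b} := by
  constructor
  · rintro ⟨φ, hinj, hv, he⟩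
    refine ⟨fun a => φ a, fun a b h => ?_, fun a => hv _ ?_, fun a b hab => ?_⟩
    · exact Fin.ext (hinj (by simp [completeHG]) (by simp [completeHG]) h)
    · simp [completeHG]
    · have hne : (a : ℕ) ≠ b := fun h => hab (Fin.ext h)
      have := he {(a : ℕ), (b : ℕ)} (by
        simp only [completeHG, Finset.mem_powersetCard, Finset.card_pair hne, and_true]
        intro x hx
        rcases Finset.mem_insert.mp hx with rfl | hx
        · simp
        · rw [Finset.mem_singleton.mp hx]
          simp)
      simpa [Finset.image_insert] using this
  · rintro ⟨k, hinj, hv, he⟩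
    refine ⟨fun n => if h : n < m then k ⟨n, h⟩ else 0, ?_, ?_, ?_⟩
    · intro a ha b hb h
      simp only [completeHG, Finset.coe_range, Set.mem_Iio] at ha hb
      simp only [ha, hb, dif_pos] at h
      simpa using hinj h
    · intro a ha
      simp only [completeHG, Finset.mem_range] at ha
      simp only [ha, dif_pos]
      exact hv _
    · intro e hmem
      obtain ⟨hsub, hcard⟩ := Finset.mem_powersetCard.mp hmem
      obtain ⟨a, b, hab, rfl⟩ := Finset.card_eq_two.mp hcard
      have ha : a < m := Finset.mem_range.mp (hsub (by simp))
      have hb : b < m := Finset.mem_range.mp (hsub (by simp))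
      simpa [Finset.image_insert, ha, hb] using
        he (i := ⟨a, ha⟩) (j := ⟨b, hb⟩) (by simpa using hab)

theorem mem_edges_completeHG {m a b : ℕ} (ha : a < m) (hb : b < m) (hab : a ≠ b) :
    {a, b} ∈ (completeHG 2 m).edges := by
  simp only [completeHG, Finset.mem_powersetCard, Finset.card_pair hab, and_true]
  intro x hx
  rcases Finset.mem_insert.mp hx with rfl | hx
  · simpa using ha
  · rw [Finset.mem_singleton.mp hx]
    simpa using hb

/-- If some graph on `s + 1` vertices arrows `(K_t, K_t)`, then a coloring of `K_s` without
monochromatic `K_t` contains a `K_{t-1}` in each color. -/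
theorem exists_pred_clique {s t : ℕ} (ht : 2 ≤ t) {G : HGraph 2} (hcard : #G.verts = s + 1)
    (hG : Arrows2 G (completeHG 2 t) (completeHG 2 t)) (c : Finset ℕ → Bool)
    (hc : ∀ (d : Bool) (k : Fin t → Fin s),
      ¬ Pairwise fun a b => k a ≠ k b ∧ c {(k a : ℕ), (k b : ℕ)} = d) (d : Bool) :
    ∃ k : Fin (t - 1) → Fin s,
      Pairwise fun a b => k a ≠ k b ∧ c {(k a : ℕ), (k b : ℕ)} = d := by
  classical
  let g : G.verts ≃ Fin (s + 1) := Finset.equivFinOfCardEq hcard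
  let h : ℕ → ℕ := fun n => if hn : n ∈ G.verts then g ⟨n, hn⟩ else 0
  have hlt {n : ℕ} (hn : n ∈ G.verts) : h n < s + 1 := by
    simpa only [h, hn, dif_pos] using (g ⟨n, hn⟩).2
  have hinj {m n : ℕ} (hm : m ∈ G.verts) (hn : n ∈ G.verts) (hmn : h m = h n) : m = n := by
    simpa [h, hm, hn, Fin.val_inj] using hmn
  have main : ∃ d', HasCopyWith (completeHG 2 t) G
      fun e => (if s ∈ e.image h then d else c (e.image h)) = d' := by
    rcases hG fun e => if s ∈ e.image h then d else c (e.image h) with H | H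
    exacts [⟨_, H⟩, ⟨_, H⟩]
  obtain ⟨d', H⟩ := main
  obtain ⟨k, kinj, kv, ke⟩ := hasCopyWith_completeHG_iff.mp H
  have lt_of {a : Fin t} (ha : h (k a) ≠ s) : h (k a) < s := by
    have := hlt (kv a)
    omega
  have col {a b : Fin t} (hab : a ≠ b) (ha : h (k a) ≠ s) (hb : h (k b) ≠ s) :
      h (k a) ≠ h (k b) ∧ c {h (k a), h (k b)} = d' := by
    refine ⟨fun h' => hab (kinj (hinj (kv a) (kv b) h')), ?_⟩
    have := (ke hab).2
    simpa [Finset.image_insert, ha.symm, hb.symm] using this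
  obtain ⟨a₀, ha₀⟩ : ∃ a, h (k a) = s := by
    by_contra! hne
    refine hc d' (fun a => ⟨h (k a), lt_of (hne a)⟩) fun a b hab => ?_
    simpa [Fin.ext_iff] using col hab (hne a) (hne b)
  have hne {a : Fin t} (ha : a ≠ a₀) : h (k a) ≠ s := fun h' =>
    ha (kinj (hinj (kv a) (kv a₀) (h'.trans ha₀.symm)))
  have hd : d' = d := by
    have : Nontrivial (Fin t) := Fin.nontrivial_iff_two_le.mpr ht
    obtain ⟨b, hb⟩ := exists_ne a₀
    have := (ke hb).2
    simpa [Finset.image_insert, ha₀, eq_comm] using this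
  subst hd
  obtain ⟨t, rfl⟩ : ∃ t', t = t' + 1 := ⟨t - 1, by omega⟩
  refine ⟨fun a => ⟨h (k (a₀.succAbove a)), lt_of (hne (Fin.succAbove_ne a₀ a))⟩,
    fun a b hab => ?_⟩
  simpa [Fin.ext_iff] using col (fun h' => hab (Fin.succAbove_right_injective h'))
    (hne (Fin.succAbove_ne a₀ a)) (hne (Fin.succAbove_ne a₀ b))

/-- Transfer an arrow relation for the union of two `K_t`-free graphs to an `HGraph`. -/
theorem exists_hGraph {t m n : ℕ} {V : Type} [Finite V] (R B : SimpleGraph V)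
    (hR : ∀ k : Fin t → V, ¬ Pairwise fun a b => R.Adj (k a) (k b))
    (hB : ∀ k : Fin t → V, ¬ Pairwise fun a b => B.Adj (k a) (k b))
    (harrow : ∀ χ : V → V → Bool, (∀ u v, χ u v = χ v u) →
      (∃ k : Fin m → V, Pairwise fun a b =>
        (R ⊔ B).Adj (k a) (k b) ∧ χ (k a) (k b) = true) ∨
      ∃ k : Fin n → V, Pairwise fun a b =>
        (R ⊔ B).Adj (k a) (k b) ∧ χ (k a) (k b) = false) :
    ∃ G : HGraph 2, ¬ Arrows2 G (completeHG 2 t) (completeHG 2 t) ∧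
      Arrows2 G (completeHG 2 m) (completeHG 2 n) := by
  classical
  have := Fintype.ofFinite V
  obtain ⟨g⟩ : Nonempty (V ↪ ℕ) := ⟨(Fintype.equivFin V).toEmbedding.trans Fin.valEmbedding⟩
  have hpair (S : SimpleGraph V) {u v : V}
      (h : ∃ u' v', S.Adj u' v' ∧ ({g u, g v} : Finset ℕ) = {g u', g v'}) : S.Adj u v := by
    obtain ⟨u', v', h, he⟩ := h
    have : ({u, v} : Finset V) = {u', v'} := by
      apply Finset.map_injective g
      simpa [Finset.map_insert] using he
    have := congrArg (fun s : Finset V => (s : Set V)) this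
    simp only [Finset.coe_insert, Finset.coe_singleton, Set.pair_eq_pair_iff] at this
    rcases this with ⟨rfl, rfl⟩ | ⟨rfl, rfl⟩
    exacts [h, h.symm]
  let G : HGraph 2 :=
    { verts := Finset.univ.map g
      edges := ((Finset.univ.map g).powersetCard 2).filter
        fun e => ∃ u v, (R ⊔ B).Adj u v ∧ e = {g u, g v}
      edge_sub := fun e he => (Finset.mem_powersetCard.mp (Finset.mem_filter.mp he).1).1
      edge_card := fun e he => (Finset.mem_powersetCard.mp (Finset.mem_filter.mp he).1).2 }
  have hedge {u v : V} : {g u, g v} ∈ G.edges ↔ (R ⊔ B).Adj u v := by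
    constructor
    · exact fun h => hpair _ (Finset.mem_filter.mp h).2
    · intro h
      refine Finset.mem_filter.mpr ⟨Finset.mem_powersetCard.mpr ⟨?_, ?_⟩, u, v, h, rfl⟩
      · intro x hx
        rcases Finset.mem_insert.mp hx with rfl | hx
        · simp
        · rw [Finset.mem_singleton.mp hx]
          simp
      · exact Finset.card_pair (g.injective.ne h.ne)
  have hcopy {l : ℕ} {Q : Finset ℕ → Prop} : HasCopyWith (completeHG 2 l) G Q ↔
      ∃ k : Fin l → V, Pairwise fun a b => (R ⊔ B).Adj (k a) (k b) ∧ Q {g (k a), g (k b)} := by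
    rw [hasCopyWith_completeHG_iff]
    constructor
    · rintro ⟨k, -, hv, he⟩
      have hv' (a : Fin l) : ∃ u, g u = k a := by simpa [G] using hv a
      choose k' hk' using hv'
      refine ⟨k', fun a b hab => ?_⟩
      have := he hab
      simpa only [← hk', hedge] using this
    · rintro ⟨k, hk⟩
      refine ⟨fun a => g (k a), fun a b h => ?_, fun a => by simp [G], fun a b hab => ?_⟩
      · by_contra hab
        exact (hk hab).1.ne (g.injective h)
      · exact ⟨hedge.mpr (hk hab).1, (hk hab).2⟩
  refine ⟨G, fun h => ?_, fun c => ?_⟩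
  · rcases h fun e => decide (∃ u v, R.Adj u v ∧ e = {g u, g v}) with h | h
    · obtain ⟨k, hk⟩ := hcopy.mp h
      exact hR k fun a b hab => hpair R (of_decide_eq_true (hk hab).2)
    · obtain ⟨k, hk⟩ := hcopy.mp h
      refine hB k fun a b hab => ((hk hab).1).resolve_left fun h' => ?_
      exact of_decide_eq_false (hk hab).2 ⟨_, _, h', rfl⟩
  · rw [hcopy, hcopy]
    exact harrow (fun u v => c {g u, g v}) fun u v => by rw [Finset.pair_comm]

/-- Mendonça–Miralaei–Mota. For any `t ≥ 2` there is a graph `G` with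
`G ↛ (K_t, K_t)` and `G → (K_s, K_{t−1})`, where `s = R(K_t, K_t) − 1`. -/
theorem mmm_graphs (t : ℕ) (ht : 2 ≤ t) :
    ∃ G : HGraph 2,
      ¬ Arrows2 G (completeHG 2 t) (completeHG 2 t) ∧
        Arrows2 G (completeHG 2 (ramsey2 2 (completeHG 2 t) (completeHG 2 t) - 1))
          (completeHG 2 (t - 1)) := by
  classical
  obtain rfl | ht3 : t = 2 ∨ 3 ≤ t := by omega
  · refine exists_hGraph (V := Unit) ⊥ ⊥ ?_ ?_ ?_
    · exact fun k hk => hk (i := 0) (j := 1) (by simp)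
    · exact fun k hk => hk (i := 0) (j := 1) (by simp)
    · exact fun _ _ => .inr ⟨fun _ => (), fun a b hab =>
        absurd (Subsingleton.elim (α := Fin 1) a b) hab⟩
  rcases hr : ramsey2 2 (completeHG 2 t) (completeHG 2 t) with _ | s
  · refine exists_hGraph (V := Unit) ⊥ ⊥ ?_ ?_ ?_
    · exact fun k hk => hk (i := ⟨0, by omega⟩) (j := ⟨1, by omega⟩) (by simp)
    · exact fun k hk => hk (i := ⟨0, by omega⟩) (j := ⟨1, by omega⟩) (by simp)
    · exact fun _ _ => .inl ⟨fun _ => (), fun a => absurd a.2 (by simp)⟩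
  rw [Nat.add_sub_cancel]
  obtain ⟨G₀, hcard, hG₀⟩ : ∃ G : HGraph 2, #G.verts = s + 1 ∧
      Arrows2 G (completeHG 2 t) (completeHG 2 t) := by
    have := Nat.sInf_mem (Nat.nonempty_of_pos_sInf (hr ▸ Nat.succ_pos s :
      0 < ramsey2 2 (completeHG 2 t) (completeHG 2 t)))
    rwa [← ramsey2, hr] at this
  have hs : ¬ Arrows2 (completeHG 2 s) (completeHG 2 t) (completeHG 2 t) := fun h => by
    have : ramsey2 2 (completeHG 2 t) (completeHG 2 t) ≤ s :=
      Nat.sInf_le ⟨completeHG 2 s, by simp [completeHG], h⟩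
    omega
  rw [Arrows2] at hs
  push Not at hs
  obtain ⟨c, hctrue, hcfalse⟩ := hs
  have hc (d : Bool) (k : Fin t → Fin s) :
      ¬ Pairwise fun a b => k a ≠ k b ∧ c {(k a : ℕ), (k b : ℕ)} = d := by
    intro hk
    have : HasCopyWith (completeHG 2 t) (completeHG 2 s) fun e => c e = d := by
      refine hasCopyWith_completeHG_iff.mpr ⟨fun a => k a, fun a b h => ?_,
        fun a => by simp [completeHG], fun a b hab => ⟨?_, (hk hab).2⟩⟩
      · by_contra hab
        exact (hk hab).1 (Fin.ext h)
      · exact mem_edges_completeHG (k a).2 (k b).2 fun h => (hk hab).1 (Fin.ext h)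
    cases d
    exacts [hcfalse this, hctrue this]
  let C (d : Bool) : SimpleGraph (Fin s) :=
    { Adj := fun a b => a ≠ b ∧ c {(a : ℕ), (b : ℕ)} = d
      symm := ⟨fun a b h => ⟨h.1.symm, by rw [Finset.pair_comm]; exact h.2⟩⟩
      loopless := ⟨fun a h => h.1 rfl⟩ }
  obtain ⟨V₁, _, R₁, B₁, hd₁, hR₁, hB₁, har₁⟩ := exists_pair_arrow ht3 (C true) (C false)
    (fun h h' => by simpa using h.2.symm.trans h'.2) (hc true) (hc false)
  obtain ⟨V₂, _, B₂, R₂, -, hB₂, hR₂, har₂⟩ := exists_pair_arrow ht3 B₁ R₁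
    (fun h h' => hd₁ h' h) hB₁ hR₁
  refine exists_hGraph R₂ B₂ hR₂ hB₂ fun χ hχ => ?_
  obtain ⟨fB, fR, hf, dB, hdB⟩ := har₂ χ hχ
  obtain ⟨gR, gB, hg, dR, hdR⟩ := har₁ (fun u v => χ (fB u) (fB v)) fun u v => hχ _ _
  have hRed {a b : Fin s} (h : (C true).Adj a b) :
      (R₂ ⊔ B₂).Adj (fB (gR a)) (fB (gR b)) ∧ χ (fB (gR a)) (fB (gR b)) = dR := by
    refine ⟨.inl ?_, hdR a b h⟩
    rw [hf, hf]
    exact fR.map_adj (gR.map_adj h)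
  have hBlue {a b : Fin s} (h : (C false).Adj a b) :
      (R₂ ⊔ B₂).Adj (fB (gR a)) (fB (gR b)) ∧ χ (fB (gR a)) (fB (gR b)) = dB := by
    have := gB.map_adj h
    rw [← hg, ← hg] at this
    exact ⟨.inr (fB.map_adj this), hdB _ _ this⟩
  cases dR
  · obtain ⟨k, hk⟩ := exists_pred_clique ht hcard hG₀ c hc true
    exact .inr ⟨fun a => fB (gR (k a)), fun a b hab => hRed (hk hab)⟩
  cases dB
  · obtain ⟨k, hk⟩ := exists_pred_clique ht hcard hG₀ c hc false
    exact .inr ⟨fun a => fB (gR (k a)), fun a b hab => hBlue (hk hab)⟩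
  · refine .inl ⟨fun a => fB (gR a), fun a b hab => ?_⟩
    rcases hcol : c {(a : ℕ), (b : ℕ)} with _ | _
    exacts [hBlue ⟨hab, hcol⟩, hRed ⟨hab, hcol⟩]
end
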